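/- Assume (M_{μ⁰}) has a unique solution Q_min, Q_N minimizes (M_{N, μ⁰_N, ε_N}) for each N, parameters are such that Q_N → Q_min narrowly and J_{ε_N}(Q_N) → J(Q_min), and ρ_N(t) is the Moreau projection of e_t#Q_N. Then: (i) if f is strongly convex, ρ_N converges strongly in L²([0,T] × Ω), as a function of (t, x), towards ρ_min : (t,x) ↦ (e_t#Q_min)(x); (ii) if f(ρ) = |ρ|^m with m ≥ 2, then ρ_N converges strongly to ρ_min in L^m([0,T] × Ω). -/

import Mathlib

open MeasureTheory Filter Topology Set
open scoped ENNReal NNReal Classical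

noncomputable section

abbrev Euc (d : ℕ) : Type := EuclideanSpace ℝ (Fin d)

abbrev Traj (d : ℕ) (T : ℝ) : Type := C(Set.Icc (0:ℝ) T, Euc d)

instance (d : ℕ) (T : ℝ) : MeasurableSpace (Traj d T) := borel _
instance (d : ℕ) (T : ℝ) : BorelSpace (Traj d T) := ⟨rfl⟩

/-- evaluation of a trajectory at time `t ∈ ℝ` (projected onto `[0,T]`). -/
def evalAt {d : ℕ} {T : ℝ} (hT : 0 ≤ T) (t : ℝ) (γ : Traj d T) : Euc d :=
  γ (Set.projIcc 0 T hT t)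

/-- Narrow convergence of a sequence of measures. -/
def NarrowTendsto {X : Type*} [TopologicalSpace X] [MeasurableSpace X]
    (μ : ℕ → Measure X) (ν : Measure X) : Prop :=
  ∀ f : BoundedContinuousFunction X ℝ,
    Tendsto (fun n => ∫ x, f x ∂(μ n)) atTop (𝓝 (∫ x, f x ∂ν))

/-- Squared 2-Wasserstein distance. -/
def W2sq {X : Type*} [MeasurableSpace X] [PseudoMetricSpace X]
    (μ ν : Measure X) : ℝ≥0∞ :=
  ⨅ (π : Measure (X × X)) (_ : π.map Prod.fst = μ ∧ π.map Prod.snd = ν),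
    ∫⁻ p, ENNReal.ofReal (dist p.1 p.2 ^ 2) ∂π

/-- Uniform discrete probability measures on `N` points. -/
def IsUnifDiscrete {X : Type*} [MeasurableSpace X] (N : ℕ) (μ : Measure X) : Prop :=
  ∃ x : Fin N → X, μ = ((N : ℝ≥0∞))⁻¹ • ∑ i, MeasureTheory.Measure.dirac (x i)

/-- Shifted (by `+C`) kinetic action: equals `∫₀ᵀ (L(γ'(t)) + C) dt` if `γ ∈ W^{1,r}`,
`+∞` otherwise. -/
def actionN {d : ℕ} {T : ℝ} (L : Euc d → ℝ) (C : ℝ) (γ : Traj d T) : ℝ≥0∞ :=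
  sInf { a : ℝ≥0∞ | ∃ g : ℝ → Euc d, IntervalIntegrable g volume 0 T ∧
      (∀ s t : Set.Icc (0:ℝ) T, γ t - γ s = ∫ u in (s:ℝ)..(t:ℝ), g u) ∧
      a = ∫⁻ t in Set.Ioc (0:ℝ) T, ENNReal.ofReal (L (g t) + C) }

/-- Kinetic part of the energy: `∫_Γ L(γ) dQ(γ)`. -/
def kinE {d : ℕ} {T : ℝ} (L : Euc d → ℝ) (C : ℝ) (Q : Measure (Traj d T)) : EReal :=
  ((∫⁻ γ, actionN L C γ ∂Q : ℝ≥0∞) : EReal) - ((C * T : ℝ) : EReal)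

/-- The mean-field game energy `J`. -/
def Jfun {d : ℕ} {T : ℝ} (hT : 0 ≤ T) (L : Euc d → ℝ) (C : ℝ)
    (F : Measure (Euc d) → ℝ≥0∞) (G : Measure (Traj d T) → ℝ)
    (Q : Measure (Traj d T)) : EReal :=
  kinE L C Q
    + ((∫⁻ t in Set.Ioc (0:ℝ) T, F (Q.map (evalAt hT t)) : ℝ≥0∞) : EReal)
    + ((G Q : ℝ) : EReal)

/-- Moreau envelope of `F` with parameter `ε` in the 2-Wasserstein space. -/
def moreau {d : ℕ} (Ω : Set (Euc d)) (F : Measure (Euc d) → ℝ≥0∞) (ε : ℝ)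
    (μ : Measure (Euc d)) : ℝ≥0∞ :=
  ⨅ (ρ : Measure (Euc d)) (_ : IsProbabilityMeasure ρ ∧ ρ Ωᶜ = 0),
    W2sq μ ρ / ENNReal.ofReal (2 * ε) + F ρ

/-- The regularized energy `J_ε`. -/
def Jeps {d : ℕ} {T : ℝ} (hT : 0 ≤ T) (Ω : Set (Euc d)) (L : Euc d → ℝ) (C : ℝ)
    (F : Measure (Euc d) → ℝ≥0∞) (G : Measure (Traj d T) → ℝ) (ε : ℝ)
    (Q : Measure (Traj d T)) : EReal :=
  kinE L C Q
    + ((∫⁻ t in Set.Ioc (0:ℝ) T, moreau Ω F ε (Q.map (evalAt hT t)) : ℝ≥0∞) : EReal)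
    + ((G Q : ℝ) : EReal)


/-- positive part of an extended real number, as an element of `ℝ≥0∞` -/
def ERtoENN (x : EReal) : ℝ≥0∞ := if x = ⊤ then ⊤ else ENNReal.ofReal x.toReal

/-- integral of an `EReal`-valued function (positive part minus negative part) -/
def eintegral {α : Type*} [MeasurableSpace α] (μ : Measure α) (g : α → EReal) : EReal :=
  ((∫⁻ a, ERtoENN (g a) ∂μ : ℝ≥0∞) : EReal) - ((∫⁻ a, ERtoENN (-(g a)) ∂μ : ℝ≥0∞) : EReal)

/-- the congestion functional `F(ρ) = ∫_Ω f(ρ(x)) dx` if `ρ ≪ dx`, `+∞` otherwise -/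
def intFE {d : ℕ} (Ω : Set (Euc d)) (f : ℝ → EReal) (ρ : Measure (Euc d)) : EReal :=
  if ρ ≪ volume then
    eintegral (volume.restrict Ω) (fun x => f ((ρ.rnDeriv volume x).toReal))
  else ⊤

/-- convexity of an `EReal`-valued function on `ℝ` -/
def ConvexE (f : ℝ → EReal) : Prop :=
  ∀ a b : ℝ, ∀ u ∈ Set.Icc (0:ℝ) 1,
    f (u * a + (1 - u) * b) ≤ ((u : ℝ) : EReal) * f a + (((1 - u : ℝ)) : EReal) * f b

/-- superlinearity of an `EReal`-valued function on `ℝ` -/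
def SuperlinearE (f : ℝ → EReal) : Prop :=
  ∀ K : ℝ, ∃ M : ℝ, ∀ t : ℝ, M ≤ |t| → ((K * |t| : ℝ) : EReal) ≤ f t

/-- Moreau envelope (for a possibly `EReal`-valued congestion functional). -/
def moreauE {d : ℕ} (Ω : Set (Euc d)) (FE : Measure (Euc d) → EReal) (ε : ℝ)
    (μ : Measure (Euc d)) : EReal :=
  ⨅ (ρ : Measure (Euc d)) (_ : IsProbabilityMeasure ρ ∧ ρ Ωᶜ = 0),
    (((W2sq μ ρ / ENNReal.ofReal (2 * ε)) : ℝ≥0∞) : EReal) + FE ρ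

/-- the energy `J` with congestion `F(ρ) = ∫_Ω f(ρ) dx` -/
def JfunE {d : ℕ} {T : ℝ} (hT : 0 ≤ T) (Ω : Set (Euc d)) (L : Euc d → ℝ) (C : ℝ)
    (f : ℝ → EReal) (G : Measure (Traj d T) → ℝ) (Q : Measure (Traj d T)) : EReal :=
  kinE L C Q
    + eintegral (volume.restrict (Set.Ioc (0:ℝ) T))
        (fun t => intFE Ω f (Q.map (evalAt hT t)))
    + ((G Q : ℝ) : EReal)

/-- the regularized energy `J_ε` with congestion `F(ρ) = ∫_Ω f(ρ) dx` -/
def JepsE {d : ℕ} {T : ℝ} (hT : 0 ≤ T) (Ω : Set (Euc d)) (L : Euc d → ℝ) (C : ℝ)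
    (f : ℝ → EReal) (G : Measure (Traj d T) → ℝ) (ε : ℝ)
    (Q : Measure (Traj d T)) : EReal :=
  kinE L C Q
    + eintegral (volume.restrict (Set.Ioc (0:ℝ) T))
        (fun t => moreauE Ω (intFE Ω f) ε (Q.map (evalAt hT t)))
    + ((G Q : ℝ) : EReal)


/-- Steklov average of a curve. -/
def stek {d : ℕ} (γ : ℝ → Euc d) (h a : ℝ) : Euc d := h⁻¹ • ∫ u in a..(a + h), γ u

/-- difference quotient of a curve. -/
def dq {d : ℕ} (γ : ℝ → Euc d) (h t : ℝ) : Euc d := h⁻¹ • (γ (t + h) - γ t)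

lemma continuous_dq {d : ℕ} {γ : ℝ → Euc d} (hγ : Continuous γ) (h : ℝ) :
    Continuous (dq γ h) := by
  unfold dq; fun_prop

lemma stek_sub {d : ℕ} {γ : ℝ → Euc d} (hγ : Continuous γ) (h a b : ℝ) :
    stek γ h b - stek γ h a = ∫ t in a..b, dq γ h t := by
  have hi : ∀ x y : ℝ, IntervalIntegrable γ volume x y := fun x y => hγ.intervalIntegrable x y
  unfold stek dq
  rw [intervalIntegral.integral_smul, ← smul_sub]
  congr 1
  rw [intervalIntegral.integral_sub (by apply Continuous.intervalIntegrable; fun_prop) (hi _ _)]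
  rw [intervalIntegral.integral_comp_add_right (f := γ)]
  rw [← intervalIntegral.integral_add_adjacent_intervals (hi b (a+h)) (hi (a+h) (b+h)),
    ← intervalIntegral.integral_add_adjacent_intervals (hi a b) (hi b (a+h))]
  abel

lemma stek_tendsto {d : ℕ} {γ : ℝ → Euc d} (hγ : Continuous γ) {h : ℕ → ℝ}
    (hpos : ∀ n, 0 < h n) (hlim : Tendsto h atTop (𝓝 0)) {a : ℕ → ℝ} {a0 : ℝ}
    (ha : Tendsto a atTop (𝓝 a0)) :
    Tendsto (fun n => stek γ (h n) (a n)) atTop (𝓝 (γ a0)) := by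
  rw [Metric.tendsto_nhds]
  intro e he
  obtain ⟨δ, hδ, hd⟩ := Metric.continuous_iff.1 hγ a0 (e/2) (by positivity)
  have h1 := Metric.tendsto_nhds.1 ha (δ/2) (by positivity)
  have h2 := Metric.tendsto_nhds.1 hlim (δ/2) (by positivity)
  filter_upwards [h1, h2] with n h1 h2
  have hp := hpos n
  have e1 : stek γ (h n) (a n) - γ a0 = (h n)⁻¹ • ∫ u in (a n)..(a n + h n), (γ u - γ a0) := by
    rw [intervalIntegral.integral_sub (hγ.intervalIntegrable _ _) (by simp)]
    simp [stek, smul_sub, smul_smul, hp.ne']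
  rw [dist_eq_norm, e1, norm_smul]
  have : ‖∫ u in (a n)..(a n + h n), (γ u - γ a0)‖ ≤ e/2 * |a n + h n - a n| := by
    apply intervalIntegral.norm_integral_le_of_norm_le_const
    intro x hx
    rw [uIoc_of_le (by linarith)] at hx
    rw [← dist_eq_norm]
    apply (hd x _).le
    rw [Real.dist_eq] at *
    rw [abs_lt] at *
    constructor <;> [linarith [hx.1, hx.2]; linarith [hx.1, hx.2]]
  rw [add_sub_cancel_left, abs_of_pos hp] at this
  rw [Real.norm_of_nonneg (by positivity)]
  calc (h n)⁻¹ * _ ≤ (h n)⁻¹ * (e/2 * h n) := by gcongr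
    _ = e/2 := by field_simp
    _ < e := by linarith

lemma ac_bound {d : ℕ} {T : ℝ} {γ : ℝ → Euc d} (hγ : Continuous γ) {h : ℕ → ℝ}
    (hpos : ∀ n, 0 < h n) (hlim : Tendsto h atTop (𝓝 0)) {ℓ : Euc d → ℝ≥0∞} {la η M : ℝ≥0∞}
    (hl : ∀ p, ‖p‖ₑ ≤ la + η * ℓ p) (hℓ : Measurable ℓ)
    (hM : ∃ᶠ n in atTop, ∫⁻ t in Ioc 0 (T - h n), ℓ (dq γ (h n) t) ≤ M)
    {E : ℕ × (ℕ → ℝ × ℝ)} (hE : E ∈ AbsolutelyContinuousOnInterval.disjWithin 0 T) (hT : 0 ≤ T) :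
    ∑ i ∈ Finset.range E.1, edist (γ (E.2 i).1) (γ (E.2 i).2)
      ≤ la * ∑ i ∈ Finset.range E.1, edist (E.2 i).1 (E.2 i).2 + η * M := by
  set c : ℕ → ℝ := fun n => T - h n
  have hc : Tendsto c atTop (𝓝 T) := by
    simpa using tendsto_const_nhds.sub hlim
  have hEm : ∀ i ∈ Finset.range E.1, (E.2 i).1 ∈ Icc 0 T ∧ (E.2 i).2 ∈ Icc 0 T := by
    have := hE.1; rwa [uIcc_of_le hT] at this
  have key : Tendsto (fun n => ∑ i ∈ Finset.range E.1,
      edist (stek γ (h n) (min (E.2 i).1 (c n))) (stek γ (h n) (min (E.2 i).2 (c n)))) atTop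
      (𝓝 (∑ i ∈ Finset.range E.1, edist (γ (E.2 i).1) (γ (E.2 i).2))) := by
    apply tendsto_finsetSum
    intro i hi
    apply Tendsto.edist
    · apply stek_tendsto hγ hpos hlim
      have := (tendsto_const_nhds (x := (E.2 i).1)).min hc
      rwa [min_eq_left (hEm i hi).1.2] at this
    · apply stek_tendsto hγ hpos hlim
      have := (tendsto_const_nhds (x := (E.2 i).2)).min hc
      rwa [min_eq_left (hEm i hi).2.2] at this
  refine le_of_tendsto_of_frequently key (hM.mono ?_)
  intro n hn
  set U : ℕ → Set ℝ := fun i => uIoc (min (E.2 i).1 (c n)) (min (E.2 i).2 (c n))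
  have hU1 : ∀ i, U i ⊆ uIoc (E.2 i).1 (E.2 i).2 := by
    intro i x hx
    simp only [U, uIoc, mem_Ioc] at hx ⊢
    grind
  have hU2 : ∀ i ∈ Finset.range E.1, U i ⊆ Ioc 0 (c n) := by
    intro i hi x hx
    have := hEm i hi
    simp only [U, uIoc, mem_Ioc, mem_Icc] at hx this ⊢
    grind
  have hUm : ∀ i, MeasurableSet (U i) := fun i => measurableSet_uIoc
  have hUd : Set.PairwiseDisjoint (↑(Finset.range E.1)) U := by
    intro i hi j hj hij
    exact (hE.2 hi hj hij).mono (hU1 i) (hU1 j)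
  have hdqm : Measurable (fun t => ℓ (dq γ (h n) t)) := hℓ.comp (continuous_dq hγ _).measurable
  calc ∑ i ∈ Finset.range E.1,
      edist (stek γ (h n) (min (E.2 i).1 (c n))) (stek γ (h n) (min (E.2 i).2 (c n)))
      ≤ ∑ i ∈ Finset.range E.1, (la * edist (E.2 i).1 (E.2 i).2
          + η * ∫⁻ t in U i, ℓ (dq γ (h n) t)) := by
        apply Finset.sum_le_sum
        intro i hi
        rw [edist_comm, edist_eq_enorm_sub, stek_sub hγ, intervalIntegral.intervalIntegral_eq_integral_uIoc]
        have : ‖(if min (E.2 i).1 (c n) ≤ min (E.2 i).2 (c n) then (1:ℝ) else -1) • ∫ t in U i, dq γ (h n) t‖ₑ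
          ≤ ∫⁻ t in U i, ‖dq γ (h n) t‖ₑ := by
          rw [enorm_smul]
          have : ‖(if min (E.2 i).1 (c n) ≤ min (E.2 i).2 (c n) then (1:ℝ) else -1)‖ₑ = 1 := by
            split_ifs <;> simp
          rw [this, one_mul]
          exact enorm_integral_le_lintegral_enorm _
        refine this.trans ?_
        calc ∫⁻ t in U i, ‖dq γ (h n) t‖ₑ ≤ ∫⁻ t in U i, (la + η * ℓ (dq γ (h n) t)) :=
              lintegral_mono fun t => hl _
          _ = la * volume (U i) + η * ∫⁻ t in U i, ℓ (dq γ (h n) t) := by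
              rw [lintegral_add_left measurable_const, lintegral_const_mul _ hdqm]
              simp
          _ ≤ _ := by
              gcongr
              refine (measure_mono (hU1 i)).trans ?_
              simp [uIoc, edist_dist, Real.dist_eq, max_sub_min_eq_abs']
    _ = la * ∑ i ∈ Finset.range E.1, edist (E.2 i).1 (E.2 i).2
        + η * ∑ i ∈ Finset.range E.1, ∫⁻ t in U i, ℓ (dq γ (h n) t) := by
        rw [Finset.sum_add_distrib, Finset.mul_sum, Finset.mul_sum]
    _ ≤ _ := by
        gcongr
        rw [← lintegral_biUnion_finset hUd (fun i _ => hUm i)]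
        refine (lintegral_mono_set ?_).trans hn
        exact iUnion₂_subset hU2

lemma ac_of_liminf {d : ℕ} {T : ℝ} {γ : ℝ → Euc d} (hγ : Continuous γ) {h : ℕ → ℝ}
    (hpos : ∀ n, 0 < h n) (hlim : Tendsto h atTop (𝓝 0)) {ℓ : Euc d → ℝ≥0∞}
    (hl : ∀ η : ℝ≥0, 0 < η → ∃ la : ℝ≥0, ∀ p, ‖p‖ₑ ≤ la + η * ℓ p) (hℓ : Measurable ℓ)
    (hM : liminf (fun n => ∫⁻ t in Ioc 0 (T - h n), ℓ (dq γ (h n) t)) atTop ≠ ⊤) (hT : 0 ≤ T)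
    (i : Fin d) :
    AbsolutelyContinuousOnInterval (fun t => γ t i) 0 T := by
  obtain ⟨M, hM1⟩ : ∃ M : ℝ≥0, ∃ᶠ n in atTop, ∫⁻ t in Ioc 0 (T - h n), ℓ (dq γ (h n) t) ≤ M := by
    obtain ⟨M, h1, -⟩ := ENNReal.lt_iff_exists_nnreal_btwn.1 (lt_top_iff_ne_top.2 hM)
    exact ⟨M, (frequently_lt_of_liminf_lt (by isBoundedDefault) h1).mono fun _ h => h.le⟩
  rw [absolutelyContinuousOnInterval_iff]
  intro e he
  obtain ⟨la, hla⟩ := hl (Real.toNNReal (e / (4 * (M+1)))) (by simp; positivity)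
  refine ⟨e / (4 * (la + 1)), by positivity, fun E hE hs => ?_⟩
  have := ac_bound hγ hpos hlim hla hℓ hM1 hE hT
  have e1 : ∑ i ∈ Finset.range E.1, edist (γ (E.2 i).1) (γ (E.2 i).2) =
    ENNReal.ofReal (∑ i ∈ Finset.range E.1, dist (γ (E.2 i).1) (γ (E.2 i).2)) := by
    rw [ENNReal.ofReal_sum_of_nonneg (fun _ _ => dist_nonneg)]; simp [edist_dist]
  have e2 : ∑ i ∈ Finset.range E.1, edist ((E.2 i).1) ((E.2 i).2) =
    ENNReal.ofReal (∑ i ∈ Finset.range E.1, dist ((E.2 i).1) ((E.2 i).2)) := by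
    rw [ENNReal.ofReal_sum_of_nonneg (fun _ _ => dist_nonneg)]; simp [edist_dist]
  rw [e1, e2] at this
  have hs0 : 0 ≤ ∑ i ∈ Finset.range E.1, dist ((E.2 i).1) ((E.2 i).2) :=
    Finset.sum_nonneg fun _ _ => dist_nonneg
  set S := ∑ i ∈ Finset.range E.1, dist ((E.2 i).1) ((E.2 i).2)
  have e3 : (la : ℝ≥0∞) * ENNReal.ofReal S + (Real.toNNReal (e / (4 * (M+1))) : ℝ≥0) * (M : ℝ≥0∞)
     = ENNReal.ofReal (la * S + e / (4 * (M+1)) * M) := by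
    rw [ENNReal.ofReal_add (by positivity) (by positivity), ENNReal.ofReal_mul (by positivity),
      ENNReal.ofReal_mul (by positivity)]
    simp [ENNReal.ofReal]
  rw [e3, ENNReal.ofReal_le_ofReal_iff (by positivity)] at this
  have hb : ∑ j ∈ Finset.range E.1, dist (γ (E.2 j).1 i) (γ (E.2 j).2 i) ≤
      ∑ j ∈ Finset.range E.1, dist (γ (E.2 j).1) (γ (E.2 j).2) := by
    apply Finset.sum_le_sum
    intro j _
    rw [dist_eq_norm, dist_eq_norm]
    exact PiLp.norm_apply_le (γ (E.2 j).1 - γ (E.2 j).2) i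
  refine (hb.trans this).trans_lt ?_
  have a1 : la * S ≤ e / 4 := by
    calc la * S ≤ (la + 1) * (e / (4 * (la + 1))) := by gcongr; linarith
      _ = e / 4 := by field_simp
  have a2 : e / (4 * (M+1)) * M ≤ e / 4 := by
    rw [div_mul_eq_mul_div, div_le_div_iff₀ (by positivity) (by positivity)]
    nlinarith [M.2]
  linarith

lemma hasFTC_of_ac {d : ℕ} {T : ℝ} {γ : ℝ → Euc d}
    (hac : ∀ i, AbsolutelyContinuousOnInterval (fun t => γ t i) 0 T) (hT : 0 ≤ T) :
    ∃ g : ℝ → Euc d, IntervalIntegrable g volume 0 T ∧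
      (∀ s ∈ Icc 0 T, ∀ t ∈ Icc 0 T, γ t - γ s = ∫ u in s..t, g u) ∧
      (∀ᵐ t ∂(volume.restrict (Ioc 0 T)), HasDerivAt γ (g t) t) := by
  refine ⟨fun t => WithLp.toLp 2 (fun i => deriv (fun t => γ t i) t), ?_, ?_, ?_⟩
  · rw [intervalIntegrable_iff_integrableOn_Ioc_of_le hT, IntegrableOn]
    apply Integrable.of_eval_piLp
    intro i
    have := (hac i).intervalIntegrable_deriv
    rw [intervalIntegrable_iff_integrableOn_Ioc_of_le hT] at this
    exact this
  · intro s hs t ht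
    have hsub : uIcc s t ⊆ uIcc 0 T := by
      rw [uIcc_of_le hT]; exact uIcc_subset_Icc hs ht
    ext i
    have hint : IntervalIntegrable (fun t => (WithLp.toLp 2 (fun i => deriv (fun t => γ t i) t) : Euc d)) volume s t := by
      rw [intervalIntegrable_iff, IntegrableOn]; apply Integrable.of_eval_piLp
      intro j
      have := ((hac j).mono hsub).intervalIntegrable_deriv
      rw [intervalIntegrable_iff] at this
      exact this
    have h1 := ((hac i).mono hsub).integral_deriv_eq_sub
    have h2 := (EuclideanSpace.proj (𝕜 := ℝ) i : Euc d →L[ℝ] ℝ).intervalIntegral_comp_comm hint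
    simp only [PiLp.sub_apply]
    rw [← h1]
    simpa using h2
  · have : ∀ᵐ t, ∀ i, t ∈ uIcc 0 T → DifferentiableAt ℝ (fun t => γ t i) t :=
      ae_all_iff.2 fun i => (hac i).ae_differentiableAt
    rw [ae_restrict_iff' measurableSet_Ioc]
    filter_upwards [this] with t h1 ht
    have h2 : HasDerivAt (fun t => (γ t).ofLp) (fun i => deriv (fun t => γ t i) t) t := by
      rw [hasDerivAt_pi]
      intro i
      exact (h1 i (by rw [uIcc_of_le hT]; exact Ioc_subset_Icc_self ht)).hasDerivAt
    exact ((EuclideanSpace.equiv (Fin d) ℝ).symm.toContinuousLinearMap.hasFDerivAt).comp_hasDerivAt t h2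

lemma superlin_of_growth {d : ℕ} {r C : ℝ} (hr : 1 < r) (hC : 0 < C) {L : Euc d → ℝ}
    (hLgrow : ∀ p : Euc d, 1 / (r * C) * ‖p‖ ^ r - C ≤ L p) (η : ℝ≥0) (hη : 0 < η) :
    ∃ la : ℝ≥0, ∀ p, ‖p‖ₑ ≤ la + η * ENNReal.ofReal (L p + C) := by
  have hη' : (0:ℝ) < η := hη
  refine ⟨Real.toNNReal ((r * C / η) ^ (1 / (r - 1))), fun p => ?_⟩
  have key : ‖p‖ ≤ (r * C / η) ^ (1 / (r - 1)) + η * (L p + C) := by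
    have h1 := hLgrow p
    have h2 : 0 ≤ 1 / (r * C) * ‖p‖ ^ r := by positivity
    rcases le_total ‖p‖ ((r * C / η) ^ (1 / (r - 1))) with h | h
    · have : 0 ≤ η * (L p + C) := mul_nonneg hη'.le (by linarith)
      linarith
    · have h3 : r * C / η ≤ ‖p‖ ^ (r - 1) := by
        have := Real.rpow_le_rpow (by positivity) h (by linarith : 0 ≤ r - 1)
        rwa [← Real.rpow_mul (by positivity), one_div_mul_cancel (by linarith), Real.rpow_one] at this
      have h0 : 0 < ‖p‖ := lt_of_lt_of_le (by positivity) h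
      have h4 : ‖p‖ ^ r = ‖p‖ ^ (r - 1) * ‖p‖ := by
        rw [← Real.rpow_add_one h0.ne']; congr 1; ring
      have h5 : ‖p‖ ≤ η * (1 / (r * C) * ‖p‖ ^ r) := by
        rw [h4]
        calc ‖p‖ = η * (1 / (r * C) * (r * C / η * ‖p‖)) := by
              field_simp
          _ ≤ _ := by gcongr
      have h6 : η * (1 / (r * C) * ‖p‖ ^ r) ≤ η * (L p + C) := by gcongr; linarith
      have : 0 ≤ (r * C / η) ^ (1 / (r - 1)) := by positivity
      linarith
  have hLC : 0 ≤ L p + C := by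
    have h1 := hLgrow p
    have h2 : 0 ≤ 1 / (r * C) * ‖p‖ ^ r := by positivity
    linarith
  rw [← ofReal_norm]
  refine (ENNReal.ofReal_le_ofReal key).trans ?_
  rw [ENNReal.ofReal_add (by positivity) (by positivity), ENNReal.ofReal_mul (by positivity)]
  simp [ENNReal.ofReal]

lemma continuous_evalAt {d : ℕ} {T : ℝ} (hT : 0 ≤ T) (γ : Traj d T) :
    Continuous (fun t => evalAt hT t γ) := by
  unfold evalAt
  exact γ.continuous.comp continuous_projIcc

lemma continuous_evalAt_uncurry {d : ℕ} {T : ℝ} (hT : 0 ≤ T) :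
    Continuous (fun p : ℝ × Traj d T => evalAt hT p.1 p.2) := by
  unfold evalAt
  exact continuous_snd.eval (continuous_projIcc.comp continuous_fst)

lemma continuous_evalAt_right {d : ℕ} {T : ℝ} (hT : 0 ≤ T) (t : ℝ) :
    Continuous (evalAt (d := d) hT t) :=
  (continuous_evalAt_uncurry hT).comp (Continuous.prodMk_right t)

/-- the Steklov action -/
def stAct {d : ℕ} {T : ℝ} (hT : 0 ≤ T) (L : Euc d → ℝ) (C h : ℝ) (γ : Traj d T) : ℝ≥0∞ :=
  ∫⁻ t in Ioc 0 (T - h), ENNReal.ofReal (L (dq (fun t => evalAt hT t γ) h t) + C)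

lemma stAct_le_actionN {d : ℕ} {T : ℝ} (hT : 0 ≤ T) {L : Euc d → ℝ} {C h : ℝ}
    (hLconv : ConvexOn ℝ Set.univ L) (hLcont : Continuous L) (hpos : ∀ p, 0 ≤ L p + C)
    (hh : 0 < h) (γ : Traj d T) : stAct hT L C h γ ≤ actionN L C γ := by
  unfold actionN
  apply le_sInf
  rintro a ⟨g, hg, hγ, rfl⟩
  by_cases hfin : ∫⁻ t in Set.Ioc (0:ℝ) T, ENNReal.ofReal (L (g t) + C) = ⊤
  · rw [hfin]; exact le_top
  rw [intervalIntegrable_iff_integrableOn_Ioc_of_le hT] at hg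
  have hLg : IntegrableOn (fun t => L (g t) + C) (Ioc 0 T) := by
    refine ⟨(hLcont.comp_aestronglyMeasurable hg.1).add aestronglyMeasurable_const, ?_⟩
    rw [hasFiniteIntegral_iff_ofReal (ae_of_all _ fun t => hpos _)]
    exact lt_top_iff_ne_top.2 hfin
  have hLg' : IntegrableOn (fun t => L (g t)) (Ioc 0 T) := by
    have h0 := hLg.sub (integrable_const C)
    exact Integrable.congr h0 (ae_of_all _ fun t => by simp)
  have step1 : ∀ t ∈ Ioc 0 (T - h),
      ENNReal.ofReal (L (dq (fun t => evalAt hT t γ) h t) + C) ≤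
      ENNReal.ofReal (h⁻¹) * ∫⁻ s in Ioc 0 T, (Ico (s-h) s).indicator (fun _ => ENNReal.ofReal (L (g s) + C)) t := by
    intro t ht
    have hsub : Ioc t (t+h) ⊆ Ioc 0 T := by
      intro s hs; exact ⟨ht.1.trans hs.1, by linarith [hs.2, ht.2]⟩
    have hdq : dq (fun t => evalAt hT t γ) h t = ⨍ s in Ioc t (t+h), g s := by
      have m1 : t + h ∈ Icc 0 T := ⟨by linarith [ht.1], by linarith [ht.2]⟩
      have m2 : t ∈ Icc 0 T := ⟨by linarith [ht.1], by linarith [ht.2]⟩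
      have := hγ ⟨t, m2⟩ ⟨t + h, m1⟩
      rw [intervalIntegral.integral_of_le (by simp; linarith)] at this
      simp only [dq, evalAt]
      rw [projIcc_of_mem hT m1, projIcc_of_mem hT m2, this, setAverage_eq]
      simp [Measure.real, hh.le]
    have hj : L (⨍ s in Ioc t (t+h), g s) ≤ ⨍ s in Ioc t (t+h), L (g s) := by
      apply hLconv.map_set_average_le hLcont.continuousOn isClosed_univ
      · simp [hh]
      · simp
      · simp
      · exact hg.mono_set hsub
      · exact hLg'.mono_set hsub
    have e1 : (⨍ s in Ioc t (t+h), L (g s)) + C = h⁻¹ * ∫ s in Ioc t (t+h), (L (g s) + C) := by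
      rw [integral_add (hLg'.mono_set hsub) (by simp), setAverage_eq]
      simp [Measure.real, hh.le]
      field_simp
    rw [hdq]
    calc ENNReal.ofReal (L (⨍ s in Ioc t (t+h), g s) + C)
        ≤ ENNReal.ofReal (h⁻¹ * ∫ s in Ioc t (t+h), (L (g s) + C)) := by
          apply ENNReal.ofReal_le_ofReal; linarith
      _ = ENNReal.ofReal (h⁻¹) * ∫⁻ s in Ioc t (t+h), ENNReal.ofReal (L (g s) + C) := by
          rw [ENNReal.ofReal_mul (by positivity),
            ofReal_integral_eq_lintegral_ofReal (hLg.mono_set hsub) (ae_of_all _ fun s => hpos _)]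
      _ ≤ _ := by
          refine mul_le_mul' le_rfl ?_
          rw [← lintegral_indicator measurableSet_Ioc, ← lintegral_indicator measurableSet_Ioc]
          apply lintegral_mono_ae
          have : ∀ᵐ s : ℝ, s ≠ t := by simp [ae_iff, measure_singleton]
          filter_upwards [this] with s hs0
          by_cases hs : s ∈ Ioc t (t+h)
          · rw [indicator_of_mem hs, indicator_of_mem (hsub hs), indicator_of_mem]
            exact ⟨by linarith [hs.2], hs.1⟩
          · rw [indicator_of_notMem hs]; exact zero_le
  calc stAct hT L C h γ ≤ ∫⁻ t in Ioc 0 (T - h), ENNReal.ofReal (h⁻¹) *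
        ∫⁻ s in Ioc 0 T, (Ico (s-h) s).indicator (fun _ => ENNReal.ofReal (L (g s) + C)) t :=
        setLIntegral_mono' measurableSet_Ioc step1
    _ = ENNReal.ofReal (h⁻¹) * ∫⁻ t in Ioc 0 (T - h), 
        ∫⁻ s in Ioc 0 T, (Ico (s-h) s).indicator (fun _ => ENNReal.ofReal (L (g s) + C)) t :=
        lintegral_const_mul' _ _ ENNReal.ofReal_ne_top
    _ = ENNReal.ofReal (h⁻¹) * ∫⁻ s in Ioc 0 T, ∫⁻ t in Ioc 0 (T - h), 
         (Ico (s-h) s).indicator (fun _ => ENNReal.ofReal (L (g s) + C)) t := by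
        congr 1
        apply lintegral_lintegral_swap
        have : AEMeasurable (fun p : ℝ × ℝ => ENNReal.ofReal (L (g p.2) + C))
          ((volume.restrict (Ioc 0 (T-h))).prod (volume.restrict (Ioc 0 T))) :=
          (hLg.1.aemeasurable.ennreal_ofReal).comp_snd
        have hm : MeasurableSet {p : ℝ × ℝ | p.2 - h ≤ p.1 ∧ p.1 < p.2} := by
          have a1 : MeasurableSet {p : ℝ × ℝ | p.2 - h ≤ p.1} :=
            measurableSet_le (by fun_prop) (by fun_prop)
          have a2 : MeasurableSet {p : ℝ × ℝ | p.1 < p.2} :=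
            measurableSet_lt (by fun_prop) (by fun_prop)
          exact a1.inter a2
        refine (this.indicator hm).congr (ae_of_all _ fun p => ?_)
        simp [Function.uncurry, indicator, mem_Ico]
    _ ≤ ENNReal.ofReal (h⁻¹) * ∫⁻ s in Ioc 0 T, ENNReal.ofReal (L (g s) + C) * ENNReal.ofReal h := by
        gcongr with s
        refine (lintegral_mono' Measure.restrict_le_self le_rfl).trans ?_
        rw [lintegral_indicator_const measurableSet_Ico]
        simp
    _ = _ := by
        rw [lintegral_mul_const' _ _ ENNReal.ofReal_ne_top, mul_comm, mul_assoc, ← ENNReal.ofReal_mul hh.le,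
          mul_inv_cancel₀ hh.ne']
        simp

lemma actionN_le_liminf {d : ℕ} {T : ℝ} (hT : 0 < T) {r C : ℝ} {L : Euc d → ℝ}
    (hr : 1 < r) (hC : 0 < C) (hLcont : Continuous L)
    (hLgrow : ∀ p : Euc d, 1 / (r * C) * ‖p‖ ^ r - C ≤ L p) {h : ℕ → ℝ}
    (hpos : ∀ n, 0 < h n) (hlim : Tendsto h atTop (𝓝 0)) (γ : Traj d T) :
    actionN L C γ ≤ liminf (fun n => stAct hT.le L C (h n) γ) atTop := by
  by_cases hM : liminf (fun n => stAct hT.le L C (h n) γ) atTop = ⊤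
  · rw [hM]; exact le_top
  have hγ := continuous_evalAt hT.le γ
  have hLm : Measurable (fun p => ENNReal.ofReal (L p + C)) := by fun_prop
  obtain ⟨g, hg1, hg2, hg3⟩ := hasFTC_of_ac (ac_of_liminf hγ hpos hlim
    (superlin_of_growth hr hC hLgrow) hLm hM hT.le) hT.le
  have hle : actionN L C γ ≤ ∫⁻ t in Set.Ioc (0:ℝ) T, ENNReal.ofReal (L (g t) + C) := by
    apply sInf_le
    refine ⟨g, hg1, fun s t => ?_, rfl⟩
    rw [← hg2 s s.2 t t.2]
    simp [evalAt]
  refine hle.trans ?_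
  have e : ∀ n, stAct hT.le L C (h n) γ = ∫⁻ t in Ioc 0 T, (Ioc 0 (T - h n)).indicator
      (fun t => ENNReal.ofReal (L (dq (fun t => evalAt hT.le t γ) (h n) t) + C)) t := by
    intro n
    rw [lintegral_indicator measurableSet_Ioc, Measure.restrict_restrict measurableSet_Ioc,
      inter_eq_left.2 (Ioc_subset_Ioc_right (by linarith [hpos n]))]
    rfl
  simp_rw [e]
  refine le_trans ?_ (lintegral_liminf_le ?_)
  · have hT' : ∀ᵐ t ∂(volume.restrict (Ioc 0 T)), t ≠ T := by
      apply ae_restrict_of_ae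
      simp [ae_iff, measure_singleton]
    apply lintegral_mono_ae
    filter_upwards [hg3, hT', ae_restrict_mem measurableSet_Ioc] with t h1 h2 h3
    apply le_of_eq
    symm
    apply Tendsto.liminf_eq
    have h4 : ∀ᶠ n in atTop, t ∈ Ioc 0 (T - h n) := by
      have : 0 < T - t := by
        have := lt_of_le_of_ne h3.2 h2; linarith
      filter_upwards [hlim.eventually (gt_mem_nhds this)] with n hn
      exact ⟨h3.1, by linarith⟩
    have h5 : Tendsto (fun n => dq (fun t => evalAt hT.le t γ) (h n) t) atTop (𝓝 (g t)) := by
      have := h1.tendsto_slope_zero.comp (f := h) (x := atTop) (tendsto_nhdsWithin_iff.2 ⟨hlim, by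
        exact Eventually.of_forall fun n => (hpos n).ne'⟩)
      exact this
    have h6 : Tendsto (fun n => ENNReal.ofReal (L (dq (fun t => evalAt hT.le t γ) (h n) t) + C)) atTop
      (𝓝 (ENNReal.ofReal (L (g t) + C))) := by
      apply ENNReal.tendsto_ofReal
      exact ((hLcont.tendsto _).comp h5).add_const C
    refine h6.congr' ?_
    filter_upwards [h4] with n hn
    rw [indicator_of_mem hn]
  · intro n
    apply Measurable.indicator _ measurableSet_Ioc
    exact hLm.comp (continuous_dq hγ _).measurable

lemma lintegral_le_liminf_of_narrow {X : Type*} [TopologicalSpace X] [MeasurableSpace X]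
    [OpensMeasurableSpace X] {μ : ℕ → Measure X} {ν : Measure X} [∀ n, IsFiniteMeasure (μ n)]
    [IsFiniteMeasure ν] (h : NarrowTendsto μ ν) {φ : X → ℝ} (hφ : Continuous φ) (h0 : ∀ x, 0 ≤ φ x) :
    ∫⁻ x, ENNReal.ofReal (φ x) ∂ν ≤ liminf (fun n => ∫⁻ x, ENNReal.ofReal (φ x) ∂(μ n)) atTop := by
  let F : ℕ → BoundedContinuousFunction X ℝ := fun k =>
    BoundedContinuousFunction.ofNormedAddCommGroup (fun x => min (φ x) k) (by fun_prop) k (by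
      intro x
      rw [Real.norm_of_nonneg (le_min (h0 x) (by positivity))]
      exact min_le_right _ _)
  have hF : ∀ k x, F k x = min (φ x) k := fun k x => rfl
  have hF0 : ∀ k x, 0 ≤ F k x := fun k x => by rw [hF]; exact le_min (h0 x) (by positivity)
  have e : ∀ x, ENNReal.ofReal (φ x) = ⨆ k, ENNReal.ofReal (F k x) := by
    intro x
    apply le_antisymm
    · obtain ⟨k, hk⟩ := exists_nat_ge (φ x)
      refine le_iSup_of_le k ?_
      rw [hF, min_eq_left hk]
    · exact iSup_le fun k => ENNReal.ofReal_le_ofReal (min_le_left _ _)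
  simp_rw [e]
  rw [lintegral_iSup (fun k => by
    have := (F k).continuous.measurable
    fun_prop) (by
    intro k l hkl x
    apply ENNReal.ofReal_le_ofReal
    rw [hF, hF]
    gcongr)]
  apply iSup_le
  intro k
  have e2 : ∀ (m : Measure X) [IsFiniteMeasure m], ∫⁻ x, ENNReal.ofReal (F k x) ∂m = ENNReal.ofReal (∫ x, F k x ∂m) := by
    intro m _
    rw [ofReal_integral_eq_lintegral_ofReal ((F k).integrable m) (ae_of_all _ (hF0 k))]
  have := (ENNReal.tendsto_ofReal (h (F k))).liminf_eq
  rw [e2, ← this]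
  refine liminf_le_liminf (Eventually.of_forall fun n => ?_)
  rw [← e2]
  apply lintegral_mono
  intro x
  exact le_iSup (fun k => ENNReal.ofReal (F k x)) k

lemma kin_lsc {d : ℕ} {T : ℝ} (hT : 0 < T) {r C : ℝ} {L : Euc d → ℝ}
    (hr : 1 < r) (hC : 0 < C) (hLconv : ConvexOn ℝ Set.univ L) (hLcont : Continuous L)
    (hLgrow : ∀ p : Euc d, 1 / (r * C) * ‖p‖ ^ r - C ≤ L p)
    {Q : ℕ → Measure (Traj d T)} {Q' : Measure (Traj d T)} [∀ n, IsFiniteMeasure (Q n)]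
    [IsFiniteMeasure Q'] (h : NarrowTendsto Q Q') :
    ∫⁻ γ, actionN L C γ ∂Q' ≤ liminf (fun n => ∫⁻ γ, actionN L C γ ∂(Q n)) atTop := by
  have hLC : ∀ p, 0 ≤ L p + C := by
    intro p
    have h1 := hLgrow p
    have h2 : 0 ≤ 1 / (r * C) * ‖p‖ ^ r := by
      have : 0 < r := by linarith
      positivity
    linarith
  set hs : ℕ → ℝ := fun n => 1 / ((n:ℝ) + 1)
  have hpos : ∀ n, 0 < hs n := fun n => by positivity
  have hlim : Tendsto hs atTop (𝓝 0) := tendsto_one_div_add_atTop_nhds_zero_nat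
  have hcont : ∀ s : ℝ, Continuous (fun p : ℝ × Traj d T =>
      L (dq (fun t => evalAt hT.le t p.2) s p.1) + C) := by
    intro s
    refine (hLcont.comp ?_).add continuous_const
    unfold dq
    have h1 : Continuous (fun p : ℝ × Traj d T => evalAt hT.le (p.1 + s) p.2) :=
      (continuous_evalAt_uncurry (d := d) hT.le).comp
        ((continuous_fst.add continuous_const).prodMk continuous_snd)
    exact (h1.sub (continuous_evalAt_uncurry hT.le)).const_smul (s⁻¹ : ℝ)
  have hmeas : ∀ s, Measurable (fun p : ℝ × Traj d T =>
      ENNReal.ofReal (L (dq (fun t => evalAt hT.le t p.2) s p.1) + C)) := fun s =>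
      (hcont s).measurable.ennreal_ofReal
  have swap : ∀ s (m : Measure (Traj d T)) [IsFiniteMeasure m], ∫⁻ γ, stAct hT.le L C s γ ∂m =
      ∫⁻ t in Ioc 0 (T - s), ∫⁻ γ, ENNReal.ofReal (L (dq (fun t => evalAt hT.le t γ) s t) + C) ∂m := by
    intro s m _
    unfold stAct
    rw [lintegral_lintegral_swap]
    exact ((hmeas s).comp measurable_swap).aemeasurable
  have hst : ∀ s, ∫⁻ γ, stAct hT.le L C s γ ∂Q' ≤ liminf (fun n => ∫⁻ γ, stAct hT.le L C s γ ∂(Q n)) atTop := by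
    intro s
    rw [swap s Q']
    simp_rw [fun n => swap s (Q n)]
    refine le_trans (lintegral_mono fun t => ?_) (lintegral_liminf_le ?_)
    · exact lintegral_le_liminf_of_narrow h ((hcont s).comp (Continuous.prodMk_right t)) (fun γ => hLC _)
    · intro n
      exact (hmeas s).lintegral_prod_right'
  calc ∫⁻ γ, actionN L C γ ∂Q' ≤ ∫⁻ γ, liminf (fun n => stAct hT.le L C (hs n) γ) atTop ∂Q' :=
        lintegral_mono fun γ => actionN_le_liminf hT hr hC hLcont hLgrow hpos hlim γ
    _ ≤ liminf (fun n => ∫⁻ γ, stAct hT.le L C (hs n) γ ∂Q') atTop := by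
        apply lintegral_liminf_le
        intro n
        exact ((hmeas (hs n)).comp measurable_swap).lintegral_prod_right'
    _ ≤ liminf (fun _ => liminf (fun n => ∫⁻ γ, actionN L C γ ∂(Q n)) atTop) (atTop : Filter ℕ) := by
        refine liminf_le_liminf (Eventually.of_forall fun n => ?_)
        refine (hst (hs n)).trans ?_
        refine liminf_le_liminf (Eventually.of_forall fun k => ?_)
        exact lintegral_mono fun γ => stAct_le_actionN hT.le hLconv hLcont hLC (hpos n) γ
    _ = _ := by simp

lemma eint_mono {α : Type*} [MeasurableSpace α] {μ : Measure α} {g h : α → EReal}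
    (hgh : ∀ᵐ a ∂μ, g a ≤ h a) : eintegral μ g ≤ eintegral μ h := by
  unfold eintegral
  apply EReal.sub_le_sub
  · rw [EReal.coe_ennreal_le_coe_ennreal_iff]
    exact lintegral_mono_ae (hgh.mono fun a ha => EReal.toENNReal_le_toENNReal ha)
  · rw [EReal.coe_ennreal_le_coe_ennreal_iff]
    exact lintegral_mono_ae (hgh.mono fun a ha =>
      EReal.toENNReal_le_toENNReal (EReal.neg_le_neg_iff.2 ha))

lemma eint_congr {α : Type*} [MeasurableSpace α] {μ : Measure α} {g h : α → EReal}
    (hgh : ∀ᵐ a ∂μ, g a = h a) : eintegral μ g = eintegral μ h :=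
  le_antisymm (eint_mono (hgh.mono fun _ h => h.le)) (eint_mono (hgh.mono fun _ h => h.ge))

lemma eint_coe {α : Type*} [MeasurableSpace α] {μ : Measure α} {h : α → ℝ}
    (hh : Integrable h μ) : eintegral μ (fun a => (h a : EReal)) = ((∫ a, h a ∂μ : ℝ) : EReal) := by
  have e : ∀ x : ℝ, ERtoENN (x : EReal) = ENNReal.ofReal x := fun x => EReal.real_coe_toENNReal x
  have h1 : ∫⁻ a, ENNReal.ofReal (h a) ∂μ ≠ ⊤ := hh.lintegral_lt_top.ne
  have h2 : ∫⁻ a, ENNReal.ofReal (-(h a)) ∂μ ≠ ⊤ := hh.neg.lintegral_lt_top.ne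
  unfold eintegral
  simp_rw [← EReal.coe_neg, e]
  rw [integral_eq_lintegral_pos_part_sub_lintegral_neg_part hh, EReal.coe_sub,
    ← EReal.coe_ennreal_toReal h1, ← EReal.coe_ennreal_toReal h2]

lemma eint_finite {α : Type*} [MeasurableSpace α] {μ : Measure α} [IsFiniteMeasure μ] {g : α → EReal}
    (hg : AEMeasurable g μ) (K : ℝ) (hK : ∀ᵐ a ∂μ, (-K : ℝ) ≤ g a) (hfin : eintegral μ g ≠ ⊤) :
    (∀ᵐ a ∂μ, g a ≠ ⊤) ∧ Integrable (fun a => (g a).toReal) μ ∧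
      eintegral μ g = ((∫ a, (g a).toReal ∂μ : ℝ) : EReal) := by
  have hneg : ∫⁻ a, ERtoENN (-(g a)) ∂μ ≠ ⊤ := by
    have : ∫⁻ a, ERtoENN (-(g a)) ∂μ ≤ ∫⁻ a, ENNReal.ofReal K ∂μ := by
      apply lintegral_mono_ae
      filter_upwards [hK] with a ha
      have : -(g a) ≤ (K : EReal) := by
        rw [EReal.neg_le]; simpa using ha
      exact EReal.toENNReal_le_toENNReal this
    refine ne_top_of_le_ne_top ?_ this
    simp [ENNReal.mul_eq_top, measure_ne_top]
  have hpos : ∫⁻ a, ERtoENN (g a) ∂μ ≠ ⊤ := by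
    intro h
    apply hfin
    unfold eintegral
    rw [h, ← EReal.coe_ennreal_toReal hneg]
    simp
  have hm : AEMeasurable (fun a => ERtoENN (g a)) μ := hg.ereal_toENNReal
  have h1 : ∀ᵐ a ∂μ, g a ≠ ⊤ := by
    filter_upwards [ae_lt_top' hm hpos] with a ha
    exact EReal.toENNReal_ne_top_iff.1 ha.ne
  have e : ∀ᵐ a ∂μ, g a = (((g a).toReal : ℝ) : EReal) := by
    filter_upwards [h1, hK] with a ha hb
    rw [EReal.coe_toReal ha]
    intro h0
    rw [h0] at hb
    exact absurd hb (by simp)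
  have h2 : Integrable (fun a => (g a).toReal) μ := by
    refine ⟨hg.ereal_toReal.aestronglyMeasurable, ?_⟩
    have : ∫⁻ a, ‖(g a).toReal‖ₑ ∂μ ≤ ∫⁻ a, (ERtoENN (g a) + ERtoENN (-(g a))) ∂μ := by
      apply lintegral_mono_ae
      filter_upwards [e] with a ha
      rw [ha]
      have : ∀ x : ℝ, ‖x‖ₑ ≤ ERtoENN (x : EReal) + ERtoENN (-(x:EReal)) := by
        intro x
        have e1 : ERtoENN (x : EReal) = ENNReal.ofReal x := EReal.real_coe_toENNReal x
        have e2 : ERtoENN (-(x : EReal)) = ENNReal.ofReal (-x) := EReal.real_coe_toENNReal (-x)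
        rw [e1, e2, Real.enorm_eq_ofReal_abs]
        rcases le_total 0 x with h | h
        · rw [abs_of_nonneg h]; exact le_self_add
        · rw [abs_of_nonpos h]; exact le_add_self
      simpa using this (g a).toReal
    refine lt_of_le_of_lt this ?_
    rw [lintegral_add_left' hm]
    exact ENNReal.add_lt_top.2 ⟨hpos.lt_top, hneg.lt_top⟩
  refine ⟨h1, h2, ?_⟩
  rw [← eint_coe h2]
  exact eint_congr e

lemma eint_ge {α : Type*} [MeasurableSpace α] {μ : Measure α} [IsFiniteMeasure μ] {g : α → EReal}
    (K : ℝ) (hK : ∀ᵐ a ∂μ, (K : ℝ) ≤ g a) : ((K * μ.real univ : ℝ) : EReal) ≤ eintegral μ g := by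
  have := eint_mono hK
  rw [eint_coe (integrable_const K)] at this
  simpa [mul_comm] using this

lemma eint_top {α : Type*} [MeasurableSpace α] {μ : Measure α} (h : μ univ ≠ 0) :
    eintegral μ (fun _ => ⊤) = ⊤ := by
  unfold eintegral
  simp [ERtoENN, ENNReal.top_mul h]

/-- properties of the integrand -/
structure GoodF (f : ℝ → EReal) : Prop where
  bot : ∀ t, f t ≠ ⊥
  conv : ConvexE f
  lsc : LowerSemicontinuous f
  sl : SuperlinearE f
  proper : ∃ s, f s ≠ ⊤

/-- Legendre transform -/
def fst (f : ℝ → EReal) (y : ℝ) : ℝ := ⨆ s : {s : ℝ // f s ≠ ⊤}, (y * s - (f s).toReal)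

lemma GoodF.coe {f : ℝ → EReal} (hf : GoodF f) {s : ℝ} (hs : f s ≠ ⊤) : (((f s).toReal : ℝ) : EReal) = f s :=
  EReal.coe_toReal hs (hf.bot s)

lemma GoodF.bdd {f : ℝ → EReal} (hf : GoodF f) (y : ℝ) :
    BddAbove (range fun s : {s : ℝ // f s ≠ ⊤} => (y * s - (f s).toReal)) := by
  obtain ⟨M, hM⟩ := hf.sl |y|
  obtain ⟨m, hm⟩ : ∃ m : ℝ, ∀ s ∈ Icc (-|M|) |M|, (m : EReal) ≤ f s := by
    obtain ⟨x, hx, hmin⟩ := LowerSemicontinuousOn.exists_isMinOn (s := Icc (-|M|) |M|) (f := f)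
      ⟨0, by simp⟩ isCompact_Icc (hf.lsc.lowerSemicontinuousOn _)
    by_cases h : f x = ⊤
    · exact ⟨0, fun s hs => by have : f x ≤ f s := hmin hs; rw [h] at this; rw [top_le_iff.1 this]; exact le_top⟩
    · refine ⟨(f x).toReal, fun s hs => ?_⟩
      rw [hf.coe h]; exact hmin hs
  refine ⟨max 0 (|y| * |M| - m), ?_⟩
  rintro _ ⟨⟨s, hs⟩, rfl⟩
  dsimp only
  have hys : y * s ≤ |y| * |s| := by rw [← abs_mul]; exact le_abs_self _
  rcases le_total M |s| with h | h
  · have := hM s h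
    rw [← hf.coe hs, EReal.coe_le_coe_iff] at this
    exact le_max_of_le_left (by linarith)
  · have h' : |s| ≤ |M| := h.trans (le_abs_self M)
    have := hm s (abs_le.1 h')
    rw [← hf.coe hs, EReal.coe_le_coe_iff] at this
    apply le_max_of_le_right
    have : |y| * |s| ≤ |y| * |M| := by gcongr
    linarith

lemma GoodF.young {f : ℝ → EReal} (hf : GoodF f) (y : ℝ) {s : ℝ} (hs : f s ≠ ⊤) :
    y * s - fst f y ≤ (f s).toReal := by
  have := le_ciSup (hf.bdd y) ⟨s, hs⟩
  unfold fst
  dsimp only at this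
  linarith

lemma GoodF.young' {f : ℝ → EReal} (hf : GoodF f) (y s : ℝ) :
    ((y * s - fst f y : ℝ) : EReal) ≤ f s := by
  by_cases hs : f s = ⊤
  · rw [hs]; exact le_top
  · rw [← hf.coe hs, EReal.coe_le_coe_iff]; exact hf.young y hs

lemma GoodF.cont {f : ℝ → EReal} (hf : GoodF f) : Continuous (fst f) := by
  have : ConvexOn ℝ univ (fst f) := by
    refine ⟨convex_univ, fun x _ y _ a b ha hb hab => ?_⟩
    obtain ⟨s0, h0⟩ := hf.proper
    have : Nonempty {s : ℝ // f s ≠ ⊤} := ⟨⟨s0, h0⟩⟩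
    apply ciSup_le
    rintro ⟨s, hs⟩
    have h1 := hf.young x hs
    have h2 := hf.young y hs
    simp only [smul_eq_mul]
    have e : (f s).toReal = (a + b) * (f s).toReal := by rw [hab, one_mul]
    nlinarith
  exact this.locallyLipschitz.continuous

lemma GoodF.meas {f : ℝ → EReal} (hf : GoodF f) : Measurable f := hf.lsc.measurable

lemma GoodF.moreau {f : ℝ → EReal} (hf : GoodF f) {s : ℝ} (hs : f s ≠ ⊤) {a : ℝ} (ha : a < (f s).toReal) :
    ∃ y, a ≤ y * s - fst f y := by
  set S : Set (ℝ × ℝ) := {p | f p.1 ≤ (p.2 : EReal)}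
  have hconv : Convex ℝ S := by
    intro p hp q hq u v hu hv huv
    simp only [S, mem_ofPred_eq] at hp hq ⊢
    have hp' : f p.1 ≠ ⊤ := ne_top_of_le_ne_top (by simp) hp
    have hq' : f q.1 ≠ ⊤ := ne_top_of_le_ne_top (by simp) hq
    have hv' : v = 1 - u := by linarith
    have := hf.conv p.1 q.1 u ⟨hu, by linarith⟩
    rw [← hv', ← hf.coe hp', ← hf.coe hq', ← EReal.coe_mul, ← EReal.coe_mul, ← EReal.coe_add] at this
    rw [← hf.coe hp', EReal.coe_le_coe_iff] at hp
    rw [← hf.coe hq', EReal.coe_le_coe_iff] at hq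
    refine this.trans ?_
    rw [EReal.coe_le_coe_iff]
    simp only [Prod.snd_add, Prod.smul_snd, smul_eq_mul]
    gcongr
  have hclosed : IsClosed S := by
    have h1 := hf.lsc.isClosed_epigraph
    have : Continuous (fun p : ℝ × ℝ => (p.1, (p.2 : EReal))) := by
      have := continuous_coe_real_ereal
      fun_prop
    exact h1.preimage this
  have hnot : (s, a) ∉ S := by
    simp only [S, mem_ofPred_eq, not_le]
    rw [← hf.coe hs, EReal.coe_lt_coe_iff]; exact ha
  obtain ⟨φ, u, h1, h2⟩ := geometric_hahn_banach_closed_point hconv hclosed hnot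
  set α := φ (1, 0)
  set β := φ (0, 1)
  have hφ : ∀ x b : ℝ, φ (x, b) = α * x + β * b := by
    intro x b
    have : (x, b) = x • ((1:ℝ), (0:ℝ)) + b • ((0:ℝ), (1:ℝ)) := by simp
    rw [this, map_add, map_smul, map_smul]
    simp only [smul_eq_mul, α, β]; ring
  have h3 : ∀ x, f x ≠ ⊤ → α * x + β * (f x).toReal < α * s + β * a := by
    intro x hx
    have := (h1 (x, (f x).toReal) (by simp only [S, mem_ofPred_eq]; rw [hf.coe hx])).trans h2
    rwa [hφ, hφ] at this
  have hβ : β < 0 := by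
    have := h3 s hs
    by_contra h
    push Not at h
    nlinarith
  refine ⟨α / (-β), ?_⟩
  obtain ⟨s0, h0⟩ := hf.proper
  have : Nonempty {s : ℝ // f s ≠ ⊤} := ⟨⟨s0, h0⟩⟩
  have : fst f (α / (-β)) ≤ α / (-β) * s - a := by
    apply ciSup_le
    rintro ⟨x, hx⟩
    have := h3 x hx
    have hb : 0 < -β := by linarith
    have hb0 : β ≠ 0 := hβ.ne
    have e : α / (-β) * x - (f x).toReal = (α * x + β * (f x).toReal) / (-β) := by field_simp; ring
    have e' : α / (-β) * s - a = (α * s + β * a) / (-β) := by field_simp; ring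
    dsimp only
    rw [e, e']
    gcongr
  linarith

/-- convexity with a modulus, in the dual form used below -/
lemma GoodF.modulus {f : ℝ → EReal} (hf : GoodF f) {κ p a b : ℝ}
    (h : f (1 / 2 * a + (1 - 1 / 2) * b) ≤ (((1 / 2 : ℝ)) : EReal) * f a + (((1 - 1 / 2 : ℝ)) : EReal) * f b
      - ((κ * |a - b| ^ p : ℝ) : EReal)) (ha : f a ≠ ⊤) (hb : f b ≠ ⊤) (y : ℝ) :
    κ * |a - b| ^ p + y * ((a + b) / 2) - fst f y ≤ ((f a).toReal + (f b).toReal) / 2 := by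
  have h1 := (hf.young' y (1 / 2 * a + (1 - 1 / 2) * b)).trans h
  rw [← hf.coe ha, ← hf.coe hb, ← EReal.coe_mul, ← EReal.coe_mul, ← EReal.coe_add, ← EReal.coe_sub,
    EReal.coe_le_coe_iff] at h1
  linarith

lemma integral_le_toReal_lint {α : Type*} [MeasurableSpace α] {μ : Measure α} {h : α → ℝ}
    (hh : Integrable h μ) : ENNReal.ofReal (∫ a, h a ∂μ) ≤ ∫⁻ a, ENNReal.ofReal (h a) ∂μ := by
  apply ENNReal.ofReal_le_of_le_toReal
  rw [integral_eq_lintegral_pos_part_sub_lintegral_neg_part hh]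
  have : 0 ≤ (∫⁻ a, ENNReal.ofReal (-(h a)) ∂μ).toReal := ENNReal.toReal_nonneg
  linarith

lemma integrable_bdd_cont {X : Type*} [TopologicalSpace X] [MeasurableSpace X] [OpensMeasurableSpace X]
    {μ : Measure X} [IsFiniteMeasure μ] {φ : X → ℝ} (hφ : Continuous φ) {R : ℝ} (hb : ∀ x, |φ x| ≤ R) :
    Integrable φ μ :=
  Integrable.of_bound hφ.measurable.aestronglyMeasurable R (ae_of_all _ hb)

lemma w2_bound {d : ℕ} {μ ρ : Measure (Euc d)} [IsProbabilityMeasure μ] [IsProbabilityMeasure ρ]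
    {φ : Euc d → ℝ} (hφ : Continuous φ) {R δ ε : ℝ} (hb : ∀ x, |φ x| ≤ R) (hε : 0 < ε)
    (h : ∀ x y, φ x - φ y ≤ δ + dist x y ^ 2 / (2 * ε))
    (hfin : W2sq μ ρ / ENNReal.ofReal (2 * ε) ≠ ⊤) :
    ∫ x, φ x ∂μ ≤ ∫ x, φ x ∂ρ + δ + (W2sq μ ρ / ENNReal.ofReal (2 * ε)).toReal := by
  have hε2 : 0 < 2 * ε := by positivity
  have key : ENNReal.ofReal ((∫ x, φ x ∂μ - ∫ x, φ x ∂ρ - δ) * (2 * ε)) ≤ W2sq μ ρ := by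
    unfold W2sq
    refine le_iInf fun π => le_iInf fun hπ => ?_
    have hP : IsProbabilityMeasure π := by
      constructor
      have : (π.map Prod.fst) univ = 1 := by rw [hπ.1]; simp
      rwa [Measure.map_apply measurable_fst MeasurableSet.univ, preimage_univ] at this
    have i1 : Integrable (fun p : Euc d × Euc d => φ p.1) π :=
      integrable_bdd_cont (hφ.comp continuous_fst) (fun p => hb p.1)
    have i2 : Integrable (fun p : Euc d × Euc d => φ p.2) π :=
      integrable_bdd_cont (hφ.comp continuous_snd) (fun p => hb p.2)
    have e1 : ∫ x, φ x ∂μ = ∫ p, φ p.1 ∂π := by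
      rw [← hπ.1, integral_map measurable_fst.aemeasurable hφ.measurable.aestronglyMeasurable]
    have e2 : ∫ x, φ x ∂ρ = ∫ p, φ p.2 ∂π := by
      rw [← hπ.2, integral_map measurable_snd.aemeasurable hφ.measurable.aestronglyMeasurable]
    have i3 : Integrable (fun p : Euc d × Euc d => (φ p.1 - φ p.2 - δ) * (2 * ε)) π :=
      ((i1.sub i2).sub (integrable_const δ)).mul_const _
    have e3 : (∫ x, φ x ∂μ - ∫ x, φ x ∂ρ - δ) * (2 * ε) = ∫ p, (φ p.1 - φ p.2 - δ) * (2 * ε) ∂π := by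
      have a1 : ∫ p, (φ p.1 - φ p.2 - δ) ∂π = ∫ p, (φ p.1 - φ p.2) ∂π - ∫ _, δ ∂π :=
        integral_sub (i1.sub i2) (integrable_const δ)
      have a2 : ∫ p, (φ p.1 - φ p.2) ∂π = ∫ p, φ p.1 ∂π - ∫ p, φ p.2 ∂π := integral_sub i1 i2
      rw [integral_mul_const, a1, a2, e1, e2]
      simp
    rw [e3]
    refine (integral_le_toReal_lint i3).trans (lintegral_mono fun p => ENNReal.ofReal_le_ofReal ?_)
    have := h p.1 p.2
    have h2 : φ p.1 - φ p.2 - δ ≤ dist p.1 p.2 ^ 2 / (2 * ε) := by linarith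
    rwa [le_div_iff₀ hε2] at h2
  have : ENNReal.ofReal (∫ x, φ x ∂μ - ∫ x, φ x ∂ρ - δ) ≤ W2sq μ ρ / ENNReal.ofReal (2 * ε) := by
    rw [ENNReal.le_div_iff_mul_le (Or.inl (by simpa using hε)) (Or.inl ENNReal.ofReal_ne_top), ← ENNReal.ofReal_mul' hε2.le]
    exact key
  have := (ENNReal.ofReal_le_iff_le_toReal hfin).1 this
  linarith

lemma dens_integral {d : ℕ} {Ω : Set (Euc d)} (hΩ : MeasurableSet Ω) {ρ : Measure (Euc d)}
    [IsFiniteMeasure ρ] (hρ : ρ Ωᶜ = 0) (hac : ρ ≪ volume) (φ : Euc d → ℝ) :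
    ∫ x, φ x ∂ρ = ∫ x in Ω, φ x * (ρ.rnDeriv volume x).toReal := by
  have h1 := setIntegral_rnDeriv_smul (f := φ) hac hΩ
  rw [Measure.restrict_eq_self_of_ae_mem (μ := ρ) (s := Ω) (by rw [ae_iff]; exact hρ)] at h1
  rw [← h1]
  simp [mul_comm]

lemma intFE_data {d : ℕ} {f : ℝ → EReal} (hf : GoodF f) {Ω : Set (Euc d)} (hΩv : volume Ω ≠ ⊤)
    {ρ : Measure (Euc d)} (hfin : intFE Ω f ρ ≠ ⊤) :
    ρ ≪ volume ∧ (∀ᵐ x ∂(volume.restrict Ω), f ((ρ.rnDeriv volume x).toReal) ≠ ⊤) ∧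
    Integrable (fun x => (f ((ρ.rnDeriv volume x).toReal)).toReal) (volume.restrict Ω) ∧
    intFE Ω f ρ = ((∫ x in Ω, (f ((ρ.rnDeriv volume x).toReal)).toReal : ℝ) : EReal) := by
  unfold intFE at *
  split_ifs at * with h
  · have : IsFiniteMeasure ((volume : Measure (Euc d)).restrict Ω) := ⟨by simpa using hΩv.lt_top⟩
    obtain ⟨a, b, c⟩ := eint_finite (μ := volume.restrict Ω)
      (g := fun x => f ((ρ.rnDeriv volume x).toReal))
      (hf.meas.comp (Measure.measurable_rnDeriv _ _).ennreal_toReal).aemeasurable (fst f 0)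
      (ae_of_all _ fun x => by have := hf.young' 0 ((ρ.rnDeriv volume x).toReal); simpa using this) hfin
    exact ⟨h, a, b, c⟩
  · exact absurd rfl hfin

lemma intFE_ge {d : ℕ} {f : ℝ → EReal} (hf : GoodF f) {Ω : Set (Euc d)} (hΩv : volume Ω ≠ ⊤)
    (ρ : Measure (Euc d)) : ((-(fst f 0) * (volume : Measure (Euc d)).real Ω : ℝ) : EReal) ≤ intFE Ω f ρ := by
  unfold intFE
  split_ifs with h
  · have : IsFiniteMeasure ((volume : Measure (Euc d)).restrict Ω) := ⟨by simpa using hΩv.lt_top⟩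
    have := eint_ge (μ := volume.restrict Ω) (g := fun x => f ((ρ.rnDeriv volume x).toReal)) (-(fst f 0))
      (ae_of_all _ fun x => by have := hf.young' 0 ((ρ.rnDeriv volume x).toReal); simpa using this)
    simpa [Measure.real] using this
  · exact le_top

lemma ne_bot_of_ge {x : EReal} {a : ℝ} (h : (a : EReal) ≤ x) : x ≠ ⊥ := by
  rintro rfl
  simp at h

lemma proj_data {d : ℕ} {f : ℝ → EReal} (hf : GoodF f) {Ω : Set (Euc d)} (hΩv : volume Ω ≠ ⊤)
    {ρ : Measure (Euc d)} {W : ℝ≥0∞} (hfin : (W : EReal) + intFE Ω f ρ ≠ ⊤) :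
    W ≠ ⊤ ∧ intFE Ω f ρ ≠ ⊤ := by
  have hb := ne_bot_of_ge (intFE_ge hf hΩv ρ)
  constructor
  · rintro rfl
    apply hfin
    rw [EReal.coe_ennreal_top, EReal.top_add_of_ne_bot hb]
  · intro h
    rw [h, EReal.add_top_of_ne_bot (by simp)] at hfin
    exact hfin rfl

lemma fst_int {d : ℕ} {f : ℝ → EReal} (hf : GoodF f) {Ω : Set (Euc d)} (hΩv : volume Ω ≠ ⊤)
    {φ : Euc d → ℝ} (hφ : Continuous φ) {R : ℝ} (hb : ∀ x, |φ x| ≤ R) :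
    Integrable (fun x => fst f (φ x)) (volume.restrict Ω) := by
  have : IsFiniteMeasure ((volume : Measure (Euc d)).restrict Ω) := ⟨by simpa using hΩv.lt_top⟩
  obtain ⟨K, hK⟩ := (isCompact_Icc (a := -R) (b := R)).exists_bound_of_continuousOn hf.cont.continuousOn
  exact integrable_bdd_cont (hf.cont.comp hφ) (R := K) (fun x => hK _ (abs_le.1 (hb x)))

lemma phi_v_int {d : ℕ} {Ω : Set (Euc d)} {ρ : Measure (Euc d)} [IsFiniteMeasure ρ]
    {φ : Euc d → ℝ} (hφ : Continuous φ) {R : ℝ} (hb : ∀ x, |φ x| ≤ R) :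
    Integrable (fun x => φ x * (ρ.rnDeriv volume x).toReal) (volume.restrict Ω) := by
  have h1 : Integrable (fun x => (ρ.rnDeriv volume x).toReal) (volume.restrict Ω) :=
    Measure.integrable_toReal_rnDeriv.restrict
  exact h1.bdd_mul hφ.measurable.aestronglyMeasurable (c := R) (ae_of_all _ hb)

lemma S1 {d : ℕ} {f : ℝ → EReal} (hf : GoodF f) {Ω : Set (Euc d)} (hΩ : MeasurableSet Ω)
    (hΩv : volume Ω ≠ ⊤) {μ ρ : Measure (Euc d)} [IsProbabilityMeasure μ] [IsProbabilityMeasure ρ]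
    (hρ : ρ Ωᶜ = 0)
    {φ : Euc d → ℝ} (hφ : Continuous φ) {R δ ε : ℝ} (hb : ∀ x, |φ x| ≤ R) (hε : 0 < ε)
    (h : ∀ x y, φ x - φ y ≤ δ + dist x y ^ 2 / (2 * ε)) :
    ((∫ x, φ x ∂μ - (∫ x in Ω, fst f (φ x)) - δ : ℝ) : EReal) ≤
      ((W2sq μ ρ / ENNReal.ofReal (2 * ε) : ℝ≥0∞) : EReal) + intFE Ω f ρ := by
  by_cases hfin : ((W2sq μ ρ / ENNReal.ofReal (2 * ε) : ℝ≥0∞) : EReal) + intFE Ω f ρ = ⊤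
  · rw [hfin]; exact le_top
  obtain ⟨hW, hF⟩ := proj_data hf hΩv hfin
  obtain ⟨hac, hft, hi, he⟩ := intFE_data hf hΩv hF
  have hw := w2_bound hφ hb hε h hW
  rw [he, ← EReal.coe_ennreal_toReal hW, ← EReal.coe_add, EReal.coe_le_coe_iff]
  rw [dens_integral hΩ hρ hac φ] at hw
  have i1 := phi_v_int (Ω := Ω) (ρ := ρ) hφ hb
  have i2 := fst_int (Ω := Ω) hf hΩv hφ hb
  have : ∫ x in Ω, (φ x * (ρ.rnDeriv volume x).toReal - fst f (φ x)) ≤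
      ∫ x in Ω, (f ((ρ.rnDeriv volume x).toReal)).toReal := by
    apply integral_mono_ae (i1.sub i2) hi
    filter_upwards [hft] with x hx
    exact hf.young (φ x) hx
  rw [integral_sub i1 i2] at this
  linarith

lemma perT {d : ℕ} {f : ℝ → EReal} (hf : GoodF f) {Ω : Set (Euc d)} (hΩ : MeasurableSet Ω)
    (hΩv : volume Ω ≠ ⊤) {μ ρ σ : Measure (Euc d)} [IsProbabilityMeasure μ] [IsProbabilityMeasure ρ]
    [IsProbabilityMeasure σ] (hρ : ρ Ωᶜ = 0) (hσ : σ Ωᶜ = 0) (hσF : intFE Ω f σ ≠ ⊤)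
    {φ : Euc d → ℝ} (hφ : Continuous φ) {R δ ε : ℝ} (hb : ∀ x, |φ x| ≤ R) (hε : 0 < ε)
    (h : ∀ x y, φ x - φ y ≤ δ + dist x y ^ 2 / (2 * ε)) {κ p : ℝ} (hκ : 0 < κ)
    (hmod : ∀ a b y : ℝ, f a ≠ ⊤ → f b ≠ ⊤ →
      κ * |a - b| ^ p + y * ((a + b) / 2) - fst f y ≤ ((f a).toReal + (f b).toReal) / 2)
    {s : ℝ} (hs : ENNReal.ofReal s ≤ ∫⁻ x in Ω, ENNReal.ofReal
      (|(ρ.rnDeriv volume x).toReal - (σ.rnDeriv volume x).toReal| ^ p)) :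
    ((2 * κ * s + ∫ x, φ x ∂μ + ∫ x, φ x ∂σ - 2 * (∫ x in Ω, fst f (φ x)) - δ -
      (intFE Ω f σ).toReal : ℝ) : EReal) ≤
      ((W2sq μ ρ / ENNReal.ofReal (2 * ε) : ℝ≥0∞) : EReal) + intFE Ω f ρ := by
  by_cases hfin : ((W2sq μ ρ / ENNReal.ofReal (2 * ε) : ℝ≥0∞) : EReal) + intFE Ω f ρ = ⊤
  · rw [hfin]; exact le_top
  obtain ⟨hW, hF⟩ := proj_data hf hΩv hfin
  obtain ⟨hac, hft, hi, he⟩ := intFE_data hf hΩv hF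
  obtain ⟨hac', hft', hi', he'⟩ := intFE_data hf hΩv hσF
  have hw := w2_bound hφ hb hε h hW
  rw [he, he', ← EReal.coe_ennreal_toReal hW, ← EReal.coe_add, EReal.coe_le_coe_iff, EReal.toReal_coe]
  rw [dens_integral hΩ hρ hac φ] at hw
  rw [dens_integral hΩ hσ hac' φ]
  have i1 := phi_v_int (Ω := Ω) (ρ := ρ) hφ hb
  have i1' := phi_v_int (Ω := Ω) (ρ := σ) hφ hb
  have i2 := fst_int (Ω := Ω) hf hΩv hφ hb
  set v := fun x => (ρ.rnDeriv volume x).toReal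
  set u := fun x => (σ.rnDeriv volume x).toReal
  set H : Euc d → ℝ := fun x => ((f (v x)).toReal + (f (u x)).toReal) - (φ x * v x + φ x * u x)
    + 2 * fst f (φ x) with hH
  have iH : Integrable H (volume.restrict Ω) := ((hi.add hi').sub (i1.add i1')).add (i2.const_mul 2)
  have eH : ∫ x in Ω, H x = (∫ x in Ω, (f (v x)).toReal) + (∫ x in Ω, (f (u x)).toReal)
      - ((∫ x in Ω, φ x * v x) + ∫ x in Ω, φ x * u x) + 2 * ∫ x in Ω, fst f (φ x) := by
    have a1 : ∫ x in Ω, H x = (∫ x in Ω, (((f (v x)).toReal + (f (u x)).toReal) - (φ x * v x + φ x * u x)))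
        + ∫ x in Ω, 2 * fst f (φ x) := integral_add ((hi.add hi').sub (i1.add i1')) (i2.const_mul 2)
    have a2 : (∫ x in Ω, (((f (v x)).toReal + (f (u x)).toReal) - (φ x * v x + φ x * u x))) =
        (∫ x in Ω, ((f (v x)).toReal + (f (u x)).toReal)) - ∫ x in Ω, (φ x * v x + φ x * u x) :=
        integral_sub (hi.add hi') (i1.add i1')
    rw [a1, a2, integral_add hi hi', integral_add i1 i1', integral_const_mul]
  have hpt : ∀ᵐ x ∂(volume.restrict Ω), 2 * κ * |v x - u x| ^ p ≤ H x := by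
    filter_upwards [hft, hft'] with x h1 h2
    have := hmod (v x) (u x) (φ x) h1 h2
    simp only [hH]
    linarith
  have hH0 : ∀ᵐ x ∂(volume.restrict Ω), 0 ≤ H x := by
    filter_upwards [hpt] with x hx
    exact le_trans (by positivity) hx
  have hle : 2 * κ * s ≤ ∫ x in Ω, H x := by
    have h1 : ENNReal.ofReal (2 * κ) * ENNReal.ofReal s ≤ ENNReal.ofReal (∫ x in Ω, H x) := by
      calc _ ≤ ENNReal.ofReal (2 * κ) * ∫⁻ x in Ω, ENNReal.ofReal (|v x - u x| ^ p) := by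
            exact mul_le_mul' le_rfl hs
        _ = ∫⁻ x in Ω, ENNReal.ofReal (2 * κ) * ENNReal.ofReal (|v x - u x| ^ p) :=
            (lintegral_const_mul' _ _ ENNReal.ofReal_ne_top).symm
        _ ≤ ∫⁻ x in Ω, ENNReal.ofReal (H x) := by
            apply lintegral_mono_ae
            filter_upwards [hpt] with x hx
            rw [← ENNReal.ofReal_mul (by positivity)]
            exact ENNReal.ofReal_le_ofReal hx
        _ = _ := by rw [ofReal_integral_eq_lintegral_ofReal iH hH0]
    rw [← ENNReal.ofReal_mul (by positivity)] at h1
    exact (ENNReal.ofReal_le_ofReal_iff (integral_nonneg_of_ae hH0)).1 h1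
  rw [eH] at hle
  linarith

/-- greedy maximizing selection for the dual problem -/
def sel {X : Type*} (g : ℝ → ℝ) (q : ℕ → ℝ) (u : X → ℝ) : ℕ → X → ℝ
  | 0 => fun _ => q 0
  | k + 1 => fun x =>
      if sel g q u k x * u x - g (sel g q u k x) < q (k + 1) * u x - g (q (k + 1))
      then q (k + 1) else sel g q u k x

lemma sel_meas {X : Type*} [MeasurableSpace X] {g : ℝ → ℝ} (hg : Measurable g) (q : ℕ → ℝ) {u : X → ℝ}
    (hu : Measurable u) (k : ℕ) : Measurable (sel g q u k) := by
  induction k with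
  | zero => exact measurable_const
  | succ k ih =>
    refine Measurable.ite ?_ measurable_const ih
    exact measurableSet_lt ((ih.mul hu).sub (hg.comp ih)) ((measurable_const.mul hu).sub measurable_const)

lemma sel_bdd {X : Type*} (g : ℝ → ℝ) (q : ℕ → ℝ) (u : X → ℝ) (k : ℕ) :
    ∃ R, 0 ≤ R ∧ ∀ x, |sel g q u k x| ≤ R := by
  induction k with
  | zero => exact ⟨|q 0|, abs_nonneg _, fun x => le_rfl⟩
  | succ k ih =>
    obtain ⟨R, h0, hR⟩ := ih
    refine ⟨max R |q (k + 1)|, le_max_of_le_left h0, fun x => ?_⟩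
    simp only [sel]
    split_ifs
    · exact le_max_right _ _
    · exact le_max_of_le_left (hR x)

lemma sel_step {X : Type*} (g : ℝ → ℝ) (q : ℕ → ℝ) (u : X → ℝ) (k : ℕ) (x : X) :
    sel g q u k x * u x - g (sel g q u k x) ≤ sel g q u (k + 1) x * u x - g (sel g q u (k + 1) x) := by
  simp only [sel]
  split_ifs with h
  · exact h.le
  · exact le_rfl

lemma sel_ge {X : Type*} (g : ℝ → ℝ) (q : ℕ → ℝ) (u : X → ℝ) (k : ℕ) (x : X) :
    q k * u x - g (q k) ≤ sel g q u k x * u x - g (sel g q u k x) := by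
  cases k with
  | zero => exact le_rfl
  | succ k =>
    simp only [sel]
    split_ifs with h
    · exact le_rfl
    · exact not_lt.1 h

lemma fst_int_meas {X : Type*} [MeasurableSpace X] {μ : Measure X} [IsFiniteMeasure μ]
    {f : ℝ → EReal} (hf : GoodF f)
    {φ : X → ℝ} (hφ : Measurable φ) {R : ℝ} (hb : ∀ x, |φ x| ≤ R) :
    Integrable (fun x => fst f (φ x)) μ := by
  obtain ⟨K, hK⟩ := (isCompact_Icc (a := -R) (b := R)).exists_bound_of_continuousOn hf.cont.continuousOn
  exact Integrable.of_bound (hf.cont.measurable.comp hφ).aestronglyMeasurable K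
    (ae_of_all _ (fun x => hK _ (abs_le.1 (hb x))))

lemma S3 {X : Type*} [TopologicalSpace X] [NormalSpace X] [MeasurableSpace X] [BorelSpace X]
    [R1Space X] [WeaklyLocallyCompactSpace X] {μ : Measure X} [IsFiniteMeasure μ] [μ.Regular]
    {f : ℝ → EReal} (hf : GoodF f) {u : X → ℝ} (hum : Measurable u) (hui : Integrable u μ)
    (hft : ∀ᵐ x ∂μ, f (u x) ≠ ⊤) (hfi : Integrable (fun x => (f (u x)).toReal) μ) {η : ℝ} (hη : 0 < η) :
    ∃ φ : X → ℝ, Continuous φ ∧ HasCompactSupport φ ∧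
      ∫ x, (f (u x)).toReal ∂μ - η ≤ ∫ x, φ x * u x ∂μ - ∫ x, fst f (φ x) ∂μ := by
  set q : ℕ → ℝ := TopologicalSpace.denseSeq ℝ
  have hq : DenseRange q := TopologicalSpace.denseRange_denseSeq ℝ
  have hm := fun k => sel_meas hf.cont.measurable q hum k
  have iW : ∀ k, Integrable (fun x => sel (fst f) q u k x * u x - fst f (sel (fst f) q u k x)) μ := by
    intro k
    obtain ⟨R, -, hR⟩ := sel_bdd (fst f) q u k
    exact (hui.bdd_mul (hm k).aestronglyMeasurable (c := R) (ae_of_all _ hR)).sub (fst_int_meas hf (hm k) hR)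
  have hmono : ∀ x, Monotone (fun k => sel (fst f) q u k x * u x - fst f (sel (fst f) q u k x)) :=
    fun x => monotone_nat_of_le_succ fun k => sel_step _ _ _ k x
  have hlim : ∀ᵐ x ∂μ, Tendsto (fun k => sel (fst f) q u k x * u x - fst f (sel (fst f) q u k x)) atTop
      (𝓝 ((f (u x)).toReal)) := by
    filter_upwards [hft] with x hx
    refine tendsto_order.2 ⟨fun a ha => ?_, fun a ha => ?_⟩
    · obtain ⟨b, hab, hb⟩ := exists_between ha
      obtain ⟨y, hy⟩ := hf.moreau hx hb
      have hc : Continuous (fun y => y * u x - fst f y) := by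
        have := hf.cont
        fun_prop
      obtain ⟨k, hk⟩ := hq.exists_mem_open (isOpen_lt continuous_const hc) ⟨y, lt_of_lt_of_le hab hy⟩
      filter_upwards [eventually_ge_atTop k] with n hn
      exact lt_of_lt_of_le hk ((sel_ge _ _ _ k x).trans (hmono x hn))
    · exact Eventually.of_forall fun k => lt_of_le_of_lt (hf.young _ hx) ha
  have hI := integral_tendsto_of_tendsto_of_monotone iW hfi (ae_of_all _ hmono) hlim
  obtain ⟨k, hk⟩ := ((tendsto_order.1 hI).1 (∫ x, (f (u x)).toReal ∂μ - η / 2) (by linarith)).exists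
  obtain ⟨R, hR0, hR⟩ := sel_bdd (fst f) q u k
  set s := sel (fst f) q u k
  have is : Integrable s μ := Integrable.of_bound (hm k).aestronglyMeasurable R (ae_of_all _ hR)
  choose ψ hψc hψi hψcont hψint using fun n : ℕ =>
    is.exists_hasCompactSupport_lintegral_sub_le (ε := ((n : ℝ≥0∞) + 1)⁻¹) (by simp)
  have hTm : TendstoInMeasure μ ψ atTop s := by
    refine tendstoInMeasure_of_tendsto_eLpNorm (p := 1) one_ne_zero
      (fun n => (hψcont n).measurable.aestronglyMeasurable) (hm k).aestronglyMeasurable ?_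
    have h0 : Tendsto (fun n : ℕ => ((n : ℝ≥0∞) + 1)⁻¹) atTop (𝓝 0) := by
      have := (tendsto_add_atTop_iff_nat 1).2 ENNReal.tendsto_inv_nat_nhds_zero
      simpa using this
    refine tendsto_of_tendsto_of_tendsto_of_le_of_le tendsto_const_nhds h0 (fun n => zero_le) (fun n => ?_)
    dsimp only
    rw [← neg_sub, eLpNorm_neg, eLpNorm_one_eq_lintegral_enorm]
    exact hψi n
  obtain ⟨ns, -, hns⟩ := hTm.exists_seq_tendsto_ae
  set χ : ℕ → X → ℝ := fun n x => max (-R) (min R (ψ (ns n) x))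
  have hχc : ∀ n, Continuous (χ n) := fun n => by
    have := hψcont (ns n)
    fun_prop
  have hχb : ∀ n x, |χ n x| ≤ R := fun n x =>
    abs_le.2 ⟨le_max_left _ _, max_le (by linarith) (min_le_left _ _)⟩
  have hχs : ∀ n, HasCompactSupport (χ n) := fun n => by
    have := (hψc (ns n)).comp_left (g := fun y => max (-R) (min R y)) (by simp [hR0])
    exact this
  have hχl : ∀ᵐ x ∂μ, Tendsto (fun n => χ n x) atTop (𝓝 (s x)) := by
    filter_upwards [hns] with x hx
    have hc : Continuous (fun y => max (-R) (min R y)) := by fun_prop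
    have h1 := (hc.tendsto (s x)).comp hx
    have h2 : max (-R) (min R (s x)) = s x := by
      rw [min_eq_right (abs_le.1 (hR x)).2, max_eq_right (abs_le.1 (hR x)).1]
    rw [h2] at h1
    exact h1
  obtain ⟨K, hK⟩ := (isCompact_Icc (a := -R) (b := R)).exists_bound_of_continuousOn hf.cont.continuousOn
  have iχ : ∀ n, Integrable (fun x => χ n x * u x) μ := fun n =>
    hui.bdd_mul (hχc n).measurable.aestronglyMeasurable (c := R) (ae_of_all _ (hχb n))
  have iχ' : ∀ n, Integrable (fun x => fst f (χ n x)) μ := fun n =>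
    fst_int_meas hf (hχc n).measurable (hχb n)
  have hlim2 : Tendsto (fun n => ∫ x, (χ n x * u x - fst f (χ n x)) ∂μ) atTop
      (𝓝 (∫ x, (s x * u x - fst f (s x)) ∂μ)) := by
    refine tendsto_integral_of_dominated_convergence (fun x => R * |u x| + K)
      (fun n => ((iχ n).sub (iχ' n)).1) ((hui.abs.const_mul R).add (integrable_const K)) (fun n => ?_) ?_
    · refine ae_of_all _ fun x => ?_
      have h1 : |χ n x * u x| ≤ R * |u x| := by
        rw [abs_mul]; exact mul_le_mul_of_nonneg_right (hχb n x) (abs_nonneg _)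
      have h2 := hK (χ n x) (abs_le.1 (hχb n x))
      exact (norm_sub_le _ _).trans (add_le_add h1 h2)
    · filter_upwards [hχl] with x hx
      exact (hx.mul_const _).sub ((hf.cont.tendsto _).comp hx)
  obtain ⟨n, hn⟩ := ((tendsto_order.1 hlim2).1 (∫ x, (s x * u x - fst f (s x)) ∂μ - η / 2) (by linarith)).exists
  refine ⟨χ n, hχc n, hχs n, ?_⟩
  rw [← integral_sub (iχ n) (iχ' n)]
  linarith

lemma uc_bound {d : ℕ} {φ : ℝ × Euc d → ℝ} (hφ : UniformContinuous φ) {R : ℝ} (hb : ∀ p, |φ p| ≤ R)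
    {ε : ℕ → ℝ} (hεpos : ∀ N, 0 < ε N) (hεlim : Tendsto ε atTop (𝓝 0)) {δ : ℝ} (hδ : 0 < δ) :
    ∀ᶠ N in atTop, ∀ t x y, φ (t, x) - φ (t, y) ≤ δ + dist x y ^ 2 / (2 * ε N) := by
  obtain ⟨η, hη, h⟩ := Metric.uniformContinuous_iff.1 hφ δ hδ
  have hR : 0 ≤ R := (abs_nonneg _).trans (hb (0, 0))
  have : Tendsto (fun N => 4 * R * ε N) atTop (𝓝 0) := by simpa using hεlim.const_mul (4 * R)
  filter_upwards [this.eventually (gt_mem_nhds (show 0 < η ^ 2 by positivity))] with N hN t x y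
  have hε := hεpos N
  by_cases hd : dist x y < η
  · have h1 : dist (t, x) (t, y) < η := by simpa [Prod.dist_eq, hη] using hd
    have h2 := h h1
    rw [Real.dist_eq] at h2
    have : 0 ≤ dist x y ^ 2 / (2 * ε N) := by positivity
    linarith [le_abs_self (φ (t, x) - φ (t, y))]
  · push Not at hd
    have h1 : 2 * R ≤ dist x y ^ 2 / (2 * ε N) := by
      rw [le_div_iff₀ (by positivity)]
      have : η ^ 2 ≤ dist x y ^ 2 := by gcongr
      nlinarith
    have h2 := abs_le.1 (hb (t, x))
    have h3 := abs_le.1 (hb (t, y))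
    linarith [h2.2, h3.1]

lemma map_integral {d : ℕ} {T : ℝ} (hT : 0 ≤ T) (Q : Measure (Traj d T)) {φ : ℝ × Euc d → ℝ}
    (hφ : Continuous φ) (t : ℝ) :
    ∫ x, φ (t, x) ∂(Q.map (evalAt hT t)) = ∫ γ, φ (t, evalAt hT t γ) ∂Q := by
  rw [integral_map (continuous_evalAt_right hT t).measurable.aemeasurable]
  exact (hφ.comp (Continuous.prodMk_right t)).measurable.aestronglyMeasurable

lemma A_meas {d : ℕ} {T : ℝ} (hT : 0 ≤ T) (Q : Measure (Traj d T)) [IsFiniteMeasure Q] {φ : ℝ × Euc d → ℝ}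
    (hφ : Continuous φ) : StronglyMeasurable (fun t => ∫ x, φ (t, x) ∂(Q.map (evalAt hT t))) := by
  simp_rw [map_integral hT Q hφ]
  apply StronglyMeasurable.integral_prod_right
  have : Continuous (fun p : ℝ × Traj d T => φ (p.1, evalAt hT p.1 p.2)) :=
    hφ.comp (continuous_fst.prodMk (continuous_evalAt_uncurry hT))
  exact this.measurable.stronglyMeasurable

lemma A_bdd {d : ℕ} {T : ℝ} (hT : 0 ≤ T) (Q : Measure (Traj d T)) [IsProbabilityMeasure Q]
    {φ : ℝ × Euc d → ℝ} {R : ℝ} (hb : ∀ p, |φ p| ≤ R) (t : ℝ) :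
    |∫ x, φ (t, x) ∂(Q.map (evalAt hT t))| ≤ R := by
  have : IsProbabilityMeasure (Q.map (evalAt hT t)) :=
    Measure.isProbabilityMeasure_map (continuous_evalAt_right hT t).measurable.aemeasurable
  have := norm_integral_le_of_norm_le_const (μ := Q.map (evalAt hT t)) (f := fun x => φ (t, x)) (C := R)
    (ae_of_all _ fun x => hb (t, x))
  simpa using this

lemma A_int {d : ℕ} {T : ℝ} (hT : 0 ≤ T) (Q : Measure (Traj d T)) [IsProbabilityMeasure Q]
    {φ : ℝ × Euc d → ℝ} (hφ : Continuous φ) {R : ℝ} (hb : ∀ p, |φ p| ≤ R) :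
    Integrable (fun t => ∫ x, φ (t, x) ∂(Q.map (evalAt hT t))) (volume.restrict (Ioc 0 T)) :=
  Integrable.of_bound (A_meas hT Q hφ).aestronglyMeasurable R (ae_of_all _ (A_bdd hT Q hb))

lemma S2 {d : ℕ} {T : ℝ} (hT : 0 ≤ T) {Q : ℕ → Measure (Traj d T)} {Q' : Measure (Traj d T)}
    [IsProbabilityMeasure Q'] (hQ : ∀ᶠ N in atTop, IsProbabilityMeasure (Q N)) (h : NarrowTendsto Q Q')
    {φ : ℝ × Euc d → ℝ} (hφ : Continuous φ) {R : ℝ} (hb : ∀ p, |φ p| ≤ R) :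
    Tendsto (fun N => ∫ t in Ioc 0 T, ∫ x, φ (t, x) ∂((Q N).map (evalAt hT t))) atTop
      (𝓝 (∫ t in Ioc 0 T, ∫ x, φ (t, x) ∂(Q'.map (evalAt hT t)))) := by
  refine tendsto_integral_filter_of_dominated_convergence (fun _ => R) ?_ ?_ (integrable_const R) ?_
  · filter_upwards [hQ] with N hN
    exact (A_meas hT (Q N) hφ).aestronglyMeasurable
  · filter_upwards [hQ] with N hN
    exact ae_of_all _ (A_bdd hT (Q N) hb)
  · refine ae_of_all _ fun t => ?_
    simp_rw [map_integral hT _ hφ]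
    have hc : Continuous (fun γ : Traj d T => φ (t, evalAt hT t γ)) :=
      hφ.comp (continuous_const.prodMk (continuous_evalAt_right hT t))
    exact h (BoundedContinuousFunction.ofNormedAddCommGroup _ hc R (fun γ => hb _))

/-- the kernel `t ↦ e_t # Q` -/
def marg {d : ℕ} {T : ℝ} (hT : 0 ≤ T) (Q : Measure (Traj d T)) [IsFiniteMeasure Q] :
    ProbabilityTheory.Kernel ℝ (Euc d) where
  toFun t := Q.map (evalAt hT t)
  measurable' := by
    refine Measure.measurable_of_measurable_coe _ fun s hs => ?_
    have e : ∀ t, (Q.map (evalAt hT t)) s =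
        Q (Prod.mk t ⁻¹' ((fun p : ℝ × Traj d T => evalAt hT p.1 p.2) ⁻¹' s)) := by
      intro t
      rw [Measure.map_apply (continuous_evalAt_right hT t).measurable hs]
      rfl
    simp_rw [e]
    exact measurable_measure_prodMk_left ((continuous_evalAt_uncurry hT).measurable hs)

lemma marg_apply {d : ℕ} {T : ℝ} (hT : 0 ≤ T) (Q : Measure (Traj d T)) [IsFiniteMeasure Q] (t : ℝ) :
    marg hT Q t = Q.map (evalAt hT t) := rfl

lemma prob_map {d : ℕ} {T : ℝ} (hT : 0 ≤ T) (Q : Measure (Traj d T)) [IsProbabilityMeasure Q] (t : ℝ) :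
    IsProbabilityMeasure (Q.map (evalAt hT t)) :=
  Measure.isProbabilityMeasure_map (continuous_evalAt_right hT t).measurable.aemeasurable

lemma rnDeriv_restrict_base {d : ℕ} {Ω : Set (Euc d)} (hΩ : MeasurableSet Ω) {σ : Measure (Euc d)}
    [IsFiniteMeasure σ] (hσ : σ Ωᶜ = 0) (hac : σ ≪ volume) :
    σ.rnDeriv (volume.restrict Ω) =ᵐ[volume.restrict Ω] σ.rnDeriv volume := by
  have h1 : σ = (volume.restrict Ω).withDensity (σ.rnDeriv volume) := by
    rw [← restrict_withDensity hΩ, Measure.withDensity_rnDeriv_eq _ _ hac]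
    exact (Measure.restrict_eq_self_of_ae_mem (μ := σ) (by rw [ae_iff]; exact hσ)).symm
  have h2 := Measure.rnDeriv_withDensity ((volume : Measure (Euc d)).restrict Ω)
    (Measure.measurable_rnDeriv σ volume)
  rw [← h1] at h2
  exact h2

lemma ac_restrict {d : ℕ} {Ω : Set (Euc d)} (hΩ : MeasurableSet Ω) {σ : Measure (Euc d)}
    (hσ : σ Ωᶜ = 0) (hac : σ ≪ volume) : σ ≪ volume.restrict Ω := by
  refine Measure.AbsolutelyContinuous.mk fun s hs h => ?_
  rw [Measure.restrict_apply hs] at h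
  have h1 := hac h
  have h2 : σ (s ∩ Ωᶜ) = 0 := measure_mono_null inter_subset_right hσ
  have : s = (s ∩ Ω) ∪ (s ∩ Ωᶜ) := by simp
  rw [this]
  exact measure_union_null h1 h2

lemma density_data {d : ℕ} {T : ℝ} (hT : 0 ≤ T) {f : ℝ → EReal} (hf : GoodF f) {Ω : Set (Euc d)}
    (hΩ : MeasurableSet Ω) (hΩv : volume Ω ≠ ⊤) (Q : Measure (Traj d T)) [IsProbabilityMeasure Q]
    (hsupp : ∀ᵐ t ∂(volume.restrict (Ioc 0 T)), (Q.map (evalAt hT t)) Ωᶜ = 0)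
    (hfin : eintegral (volume.restrict (Set.Ioc (0:ℝ) T))
        (fun t => intFE Ω f (Q.map (evalAt hT t))) ≠ ⊤) :
    (∀ᵐ t ∂(volume.restrict (Ioc 0 T)), intFE Ω f (Q.map (evalAt hT t)) ≠ ⊤) ∧
    Integrable (fun t => (intFE Ω f (Q.map (evalAt hT t))).toReal) (volume.restrict (Ioc 0 T)) ∧
    eintegral (volume.restrict (Set.Ioc (0:ℝ) T)) (fun t => intFE Ω f (Q.map (evalAt hT t))) =
      ((∫ t in Ioc 0 T, (intFE Ω f (Q.map (evalAt hT t))).toReal : ℝ) : EReal) ∧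
    ∀ η > 0, ∃ φ : ℝ × Euc d → ℝ, Continuous φ ∧ HasCompactSupport φ ∧
      (∫ t in Ioc 0 T, (intFE Ω f (Q.map (evalAt hT t))).toReal) - η ≤
        (∫ t in Ioc 0 T, ∫ x, φ (t, x) ∂(Q.map (evalAt hT t))) -
          ∫ t in Ioc 0 T, ∫ x in Ω, fst f (φ (t, x)) := by
  have hfinΩ : IsFiniteMeasure ((volume : Measure (Euc d)).restrict Ω) := ⟨by simpa using hΩv.lt_top⟩
  have hprob := prob_map hT Q
  set κ := marg hT Q
  have hκ : ProbabilityTheory.IsMarkovKernel κ := ⟨fun t => hprob t⟩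
  set η : ProbabilityTheory.Kernel ℝ (Euc d) := ProbabilityTheory.Kernel.const ℝ (volume.restrict Ω)
  set u0 : ℝ × Euc d → ℝ≥0∞ := fun p => κ.rnDeriv η p.1 p.2 with hu0
  have hu0m : Measurable u0 := ProbabilityTheory.Kernel.measurable_rnDeriv κ η
  set u : ℝ × Euc d → ℝ := fun p => (u0 p).toReal with hu
  have hum : Measurable u := hu0m.ennreal_toReal
  set S : Set ℝ := {t | κ t ≪ η t}
  have hS : MeasurableSet S := ProbabilityTheory.Kernel.measurableSet_absolutelyContinuous κ η
  have hud : ∀ t, (Q.map (evalAt hT t)) Ωᶜ = 0 → Q.map (evalAt hT t) ≪ volume →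
      ∀ᵐ x ∂(volume.restrict Ω), u (t, x) = ((Q.map (evalAt hT t)).rnDeriv volume x).toReal := by
    intro t h1 h2
    have a1 : κ.rnDeriv η t =ᵐ[volume.restrict Ω] (κ t).rnDeriv (volume.restrict Ω) :=
      ProbabilityTheory.Kernel.rnDeriv_eq_rnDeriv_measure
    filter_upwards [a1, rnDeriv_restrict_base hΩ h1 h2] with x hx1 hx2
    simp only [hu, hu0]
    rw [hx1, ← hx2]
    rfl
  -- measurability of `t ↦ F(μ_t)`
  have hFm : AEMeasurable (fun t => intFE Ω f (Q.map (evalAt hT t))) (volume.restrict (Ioc 0 T)) := by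
    have hfu : Measurable (fun p => f (u p)) := hf.meas.comp hum
    have hm1 : Measurable (fun t => eintegral (volume.restrict Ω) (fun x => f (u (t, x)))) := by
      unfold eintegral
      have m1 : Measurable (fun t => ∫⁻ x in Ω, ERtoENN (f (u (t, x)))) :=
        (Measurable.ereal_toENNReal hfu).lintegral_prod_right'
      have m2 : Measurable (fun t => ∫⁻ x in Ω, ERtoENN (-(f (u (t, x))))) :=
        (Measurable.ereal_toENNReal hfu.neg).lintegral_prod_right'
      exact m1.coe_ereal_ennreal.sub m2.coe_ereal_ennreal
    refine ⟨fun t => if t ∈ S then eintegral (volume.restrict Ω) (fun x => f (u (t, x))) else ⊤,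
      Measurable.ite hS hm1 measurable_const, ?_⟩
    filter_upwards [hsupp] with t ht
    unfold intFE
    have hiff : t ∈ S ↔ Q.map (evalAt hT t) ≪ volume := by
      constructor
      · intro h
        exact Measure.AbsolutelyContinuous.trans h Measure.absolutelyContinuous_restrict
      · intro h
        exact ac_restrict hΩ ht h
    by_cases h : Q.map (evalAt hT t) ≪ volume
    · rw [if_pos h, if_pos (hiff.2 h)]
      apply eint_congr
      filter_upwards [hud t ht h] with x hx
      rw [hx]
    · rw [if_neg h, if_neg (fun h' => h (hiff.1 h'))]
  set K : ℝ := fst f 0 * (volume : Measure (Euc d)).real Ω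
  obtain ⟨r1, r2, r3⟩ := eint_finite hFm K (ae_of_all _ fun t => by
    have := intFE_ge hf hΩv (Q.map (evalAt hT t))
    rwa [neg_mul] at this) hfin
  refine ⟨r1, r2, r3, ?_⟩
  set Λ := (volume.restrict (Ioc (0:ℝ) T)).prod ((volume : Measure (Euc d)).restrict Ω)
  have huae : ∀ᵐ t ∂(volume.restrict (Ioc 0 T)), ∀ᵐ x ∂(volume.restrict Ω),
      u (t, x) = ((Q.map (evalAt hT t)).rnDeriv volume x).toReal := by
    filter_upwards [hsupp, r1] with t h1 h2
    exact hud t h1 (intFE_data hf hΩv h2).1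
  have hui : Integrable u Λ := by
    rw [integrable_prod_iff hum.aestronglyMeasurable]
    constructor
    · filter_upwards [huae] with t ht
      refine Integrable.congr (Measure.integrable_toReal_rnDeriv.restrict) (ht.mono fun x hx => hx.symm)
    · refine (integrable_const (1:ℝ)).congr ?_
      filter_upwards [huae, hsupp, r1] with t ht h1 h2
      have := dens_integral hΩ h1 (intFE_data hf hΩv h2).1 (fun _ => 1)
      simp only [integral_const, probReal_univ, smul_eq_mul, one_mul] at this
      rw [this]
      apply integral_congr_ae
      filter_upwards [ht] with x hx
      rw [hx, Real.norm_of_nonneg ENNReal.toReal_nonneg]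
  have hft : ∀ᵐ p ∂Λ, f (u p) ≠ ⊤ := by
    rw [Measure.ae_prod_iff_ae_ae]
    · filter_upwards [huae, r1] with t ht h2
      filter_upwards [ht, (intFE_data hf hΩv h2).2.1] with x hx h3
      rwa [hx]
    · exact (hf.meas.comp hum) (measurableSet_singleton ⊤).compl
  have hfum : Measurable (fun p => (f (u p)).toReal) := (hf.meas.comp hum).ereal_toReal
  have hint : ∀ᵐ t ∂(volume.restrict (Ioc 0 T)), Integrable (fun x => (f (u (t, x))).toReal) (volume.restrict Ω) ∧
      ∫ x in Ω, (f (u (t, x))).toReal = (intFE Ω f (Q.map (evalAt hT t))).toReal := by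
    filter_upwards [huae, r1] with t ht h2
    obtain ⟨b1, b2, b3, b4⟩ := intFE_data hf hΩv h2
    have e : (fun x => (f (u (t, x))).toReal) =ᵐ[volume.restrict Ω]
        (fun x => (f (((Q.map (evalAt hT t)).rnDeriv volume x).toReal)).toReal) := by
      filter_upwards [ht] with x hx
      rw [hx]
    refine ⟨b3.congr e.symm, ?_⟩
    rw [b4, EReal.toReal_coe]
    exact integral_congr_ae e
  have hfi : Integrable (fun p => (f (u p)).toReal) Λ := by
    rw [integrable_prod_iff hfum.aestronglyMeasurable]
    refine ⟨hint.mono fun t ht => ht.1, ?_⟩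
    have hb : Integrable (fun t => (intFE Ω f (Q.map (evalAt hT t))).toReal +
      2 * |fst f 0| * (volume : Measure (Euc d)).real Ω) (volume.restrict (Ioc 0 T)) :=
      r2.add (integrable_const _)
    refine hb.mono' hfum.norm.stronglyMeasurable.integral_prod_right'.aestronglyMeasurable ?_
    filter_upwards [hint, Measure.ae_ae_of_ae_prod hft] with t ht h2
    rw [Real.norm_of_nonneg (integral_nonneg fun x => norm_nonneg _), ← ht.2]
    have : ∫ x in Ω, ((f (u (t, x))).toReal + 2 * |fst f 0|) =
        (∫ x in Ω, (f (u (t, x))).toReal) + 2 * |fst f 0| * (volume : Measure (Euc d)).real Ω := by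
      rw [integral_add ht.1 (integrable_const _)]
      simp [mul_comm]
    rw [← this]
    refine integral_mono_ae ht.1.norm (ht.1.add (integrable_const _)) ?_
    filter_upwards [h2] with x hx
    have h3 := hf.young 0 hx
    have h4 := le_abs_self (fst f 0)
    have h5 := abs_nonneg (fst f 0)
    rw [Real.norm_eq_abs, abs_le]
    constructor <;> linarith
  intro ε hε
  obtain ⟨φ, hφc, hφs, hφ⟩ := S3 (μ := Λ) hf hum hui hft hfi hε
  refine ⟨φ, hφc, hφs, ?_⟩
  obtain ⟨R, hR⟩ := hφs.exists_bound_of_continuous hφc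
  have e1 : ∫ p, (f (u p)).toReal ∂Λ = ∫ t in Ioc 0 T, (intFE Ω f (Q.map (evalAt hT t))).toReal := by
    rw [integral_prod _ hfi]
    apply integral_congr_ae
    filter_upwards [hint] with t ht
    exact ht.2
  have i2 : Integrable (fun p => φ p * u p) Λ :=
    hui.bdd_mul hφc.measurable.aestronglyMeasurable (c := R) (ae_of_all _ hR)
  have e2 : ∫ p, φ p * u p ∂Λ = ∫ t in Ioc 0 T, ∫ x, φ (t, x) ∂(Q.map (evalAt hT t)) := by
    rw [integral_prod _ i2]
    apply integral_congr_ae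
    filter_upwards [huae, hsupp, r1] with t ht h1 h2
    rw [dens_integral hΩ h1 (intFE_data hf hΩv h2).1 (fun x => φ (t, x))]
    apply integral_congr_ae
    filter_upwards [ht] with x hx
    rw [hx]
  have e3 : ∫ p, fst f (φ p) ∂Λ = ∫ t in Ioc 0 T, ∫ x in Ω, fst f (φ (t, x)) :=
    integral_prod _ (fst_int_meas hf hφc.measurable hR)
  rw [← e1, ← e2, ← e3]
  exact hφ

lemma B_int {d : ℕ} {T : ℝ} {f : ℝ → EReal} (hf : GoodF f) {Ω : Set (Euc d)} (hΩv : volume Ω ≠ ⊤)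
    {φ : ℝ × Euc d → ℝ} (hφ : Continuous φ) {R : ℝ} (hb : ∀ p, |φ p| ≤ R) :
    Integrable (fun t => ∫ x in Ω, fst f (φ (t, x))) (volume.restrict (Ioc 0 T)) := by
  have hfinΩ : IsFiniteMeasure ((volume : Measure (Euc d)).restrict Ω) := ⟨by simpa using hΩv.lt_top⟩
  exact (fst_int_meas (μ := (volume.restrict (Ioc (0:ℝ) T)).prod ((volume : Measure (Euc d)).restrict Ω))
    hf hφ.measurable hb).integral_prod_left

lemma lintegral_prod_le' {α β : Type*} [MeasurableSpace α] [MeasurableSpace β] {μ : Measure α} {ν : Measure β}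
    [SFinite ν] (F : α × β → ℝ≥0∞) : ∫⁻ p, F p ∂(μ.prod ν) ≤ ∫⁻ x, ∫⁻ y, F (x, y) ∂ν ∂μ := by
  obtain ⟨g, hg, hle, he⟩ := exists_measurable_le_lintegral_eq (μ.prod ν) F
  rw [he, lintegral_prod _ hg.aemeasurable]
  exact lintegral_mono fun x => lintegral_mono fun y => hle (x, y)

lemma unif_prob {X : Type*} [MeasurableSpace X] {N : ℕ} (hN : 1 ≤ N) {μ : Measure X} (h : IsUnifDiscrete N μ) :
    IsProbabilityMeasure μ := by
  obtain ⟨x, rfl⟩ := h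
  constructor
  have : (N : ℝ≥0∞) ≠ 0 := by simp; omega
  simp [ENNReal.inv_mul_cancel this (by simp)]

lemma unif_finite {X : Type*} [MeasurableSpace X] {N : ℕ} {μ : Measure X} (h : IsUnifDiscrete N μ) :
    IsFiniteMeasure μ := by
  rcases Nat.eq_zero_or_pos N with rfl | hN
  · obtain ⟨x, rfl⟩ := h
    simp
    infer_instance
  · have := unif_prob hN h
    infer_instance

/-- the straight line trajectory -/
def line {d : ℕ} (T : ℝ) (v : Euc d) (x : Euc d) : Traj d T := ⟨fun t => x + (t : ℝ) • v, by fun_prop⟩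

lemma continuous_line {d : ℕ} (T : ℝ) (v : Euc d) : Continuous (line T v) := by
  apply ContinuousMap.continuous_of_continuous_uncurry
  simp only [line, Function.uncurry_def, ContinuousMap.coe_mk]
  fun_prop

lemma J_ne_top {d : ℕ} (hd : 0 < d) {T : ℝ} (hT : 0 < T)
    {Ω : Set (Euc d)} (hΩc : IsCompact Ω) (hΩmeas : MeasurableSet Ω)
    {J : Measure (Traj d T) → EReal}
    {μ0 : Measure (Euc d)} (hμ0 : IsProbabilityMeasure μ0) (hμ0Ω : μ0 Ωᶜ = 0)
    {Qmin : Measure (Traj d T)}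
    (hQminmin : ∀ Q : Measure (Traj d T), IsProbabilityMeasure Q →
      Q.map (evalAt hT.le 0) = μ0 → J Qmin ≤ J Q)
    (hQminuniq : ∀ Q : Measure (Traj d T), IsProbabilityMeasure Q →
      Q.map (evalAt hT.le 0) = μ0 →
      (∀ Q' : Measure (Traj d T), IsProbabilityMeasure Q' →
        Q'.map (evalAt hT.le 0) = μ0 → J Q ≤ J Q') → Q = Qmin) : J Qmin ≠ ⊤ := by
  intro htop
  have hQv : ∀ v : Euc d, μ0.map (line T v) = Qmin := by
    intro v
    refine hQminuniq _ (Measure.isProbabilityMeasure_map (continuous_line T v).measurable.aemeasurable) ?_ ?_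
    · rw [Measure.map_map (continuous_evalAt_right hT.le 0).measurable (continuous_line T v).measurable]
      have : (evalAt hT.le 0 ∘ line T v) = id := by
        ext1 x
        simp [evalAt, line, projIcc_left]
      rw [this, Measure.map_id]
    · intro Q' h1 h2
      have := hQminmin Q' h1 h2
      rw [htop, top_le_iff] at this
      rw [this]; exact le_top
  have hT' : ∀ v : Euc d, Qmin.map (evalAt hT.le T) Ω = μ0 ((fun x => x + T • v) ⁻¹' Ω) := by
    intro v
    rw [← hQv v, Measure.map_map (continuous_evalAt_right hT.le T).measurable (continuous_line T v).measurable]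
    have : (evalAt hT.le T ∘ line T v) = fun x => x + T • v := by
      ext1 x
      simp [evalAt, line, projIcc_right]
    rw [this, Measure.map_apply (by fun_prop) hΩmeas]
  have h1 : μ0 Ω = 1 := by
    have := prob_compl_eq_zero_iff hΩmeas (μ := μ0)
    exact this.1 hμ0Ω
  obtain ⟨R, hR⟩ := hΩc.isBounded.exists_norm_le
  set v : Euc d := ((2 * |R| + 1) / T) • EuclideanSpace.single ⟨0, hd⟩ (1:ℝ)
  have hv : ‖T • v‖ = 2 * |R| + 1 := by
    simp only [v, norm_smul, EuclideanSpace.norm_single]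
    rw [Real.norm_of_nonneg hT.le, Real.norm_of_nonneg (by positivity)]
    simp
    field_simp
  have h2 : μ0 ((fun x => x + T • v) ⁻¹' Ω) = 0 := by
    refine measure_mono_null ?_ hμ0Ω
    intro x hx hxΩ
    have a1 := hR _ hx
    have a2 := hR _ hxΩ
    have a3 : ‖T • v‖ ≤ ‖x + T • v‖ + ‖x‖ := by
      have := norm_sub_le (x + T • v) x
      simpa using this
    have := le_abs_self R
    have := abs_nonneg R
    simp only at a1
    linarith
  have e0 := hT' 0
  simp only [smul_zero, add_zero, preimage_id', h1] at e0
  have e1 := hT' v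
  rw [h2, e0] at e1
  exact one_ne_zero e1

lemma clarkson {m : ℝ} (hm : 2 ≤ m) (a b : ℝ) :
    |1 / 2 * a + (1 - 1 / 2) * b| ^ m ≤ 1 / 2 * |a| ^ m + (1 - 1 / 2) * |b| ^ m - (1 / 2) ^ m * |a - b| ^ m := by
  have hp : ∀ c : ℝ, |c| ^ m = (c ^ 2) ^ (m / 2) := by
    intro c
    rw [← sq_abs, ← Real.rpow_natCast, ← Real.rpow_mul (abs_nonneg c)]
    congr 1
    push_cast; ring
  have e1 : (1 / 2 : ℝ) ^ m * |a - b| ^ m = |(a - b) / 2| ^ m := by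
    rw [← Real.mul_rpow (by norm_num) (abs_nonneg _)]
    congr 1
    rw [abs_div, abs_two]; ring
  rw [e1, hp, hp a, hp b, hp ((a - b) / 2)]
  have h1 : ((1 / 2 * a + (1 - 1 / 2) * b) ^ 2) ^ (m / 2) + (((a - b) / 2) ^ 2) ^ (m / 2) ≤
      ((1 / 2 * a + (1 - 1 / 2) * b) ^ 2 + ((a - b) / 2) ^ 2) ^ (m / 2) :=
    Real.add_rpow_le_rpow_add (by positivity) (by positivity) (by linarith)
  have h2 : (1 / 2 * a + (1 - 1 / 2) * b) ^ 2 + ((a - b) / 2) ^ 2 = (1 / 2 : ℝ) • a ^ 2 + (1 / 2 : ℝ) • b ^ 2 := by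
    simp only [smul_eq_mul]; ring
  have hc := convexOn_rpow (by linarith : 1 ≤ m / 2)
  have h3 := hc.2 (show a ^ 2 ∈ Ici (0:ℝ) from sq_nonneg a) (show b ^ 2 ∈ Ici (0:ℝ) from sq_nonneg b)
    (by norm_num : (0:ℝ) ≤ 1 / 2) (by norm_num : (0:ℝ) ≤ 1 / 2) (by norm_num)
  rw [h2] at h1
  simp only [smul_eq_mul] at h3 h1
  linarith

lemma limsup_M {kin : ℝ≥0∞} {kinN : ℕ → ℝ≥0∞} {e : EReal} {E : ℝ} {eN : ℕ → EReal} {G c : ℝ} {GN : ℕ → ℝ}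
    (hk : kin ≠ ⊤) (hkl : kin ≤ liminf kinN atTop) (hG : Tendsto GN atTop (𝓝 G)) (he : e = (E : EReal))
    (hJ : Tendsto (fun N => ((kinN N : EReal) - (c : EReal)) + eN N + (GN N : EReal)) atTop
      (𝓝 (((kin : EReal) - (c : EReal)) + e + (G : EReal)))) {η : ℝ} (hη : 0 < η) :
    ∀ᶠ N in atTop, eN N ≤ ((E + η : ℝ) : EReal) := by
  subst he
  set k := kin.toReal
  have hk' : kin = ENNReal.ofReal k := (ENNReal.ofReal_toReal hk).symm
  have ek : (kin : EReal) = (k : EReal) := (EReal.coe_ennreal_toReal hk).symm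
  rw [ek, ← EReal.coe_sub, ← EReal.coe_add, ← EReal.coe_add] at hJ
  have h1 := (tendsto_order.1 hJ).2 ((k - c + E + G + η / 4 : ℝ) : EReal)
    (EReal.coe_lt_coe_iff.2 (by linarith))
  have h2 := (tendsto_order.1 hG).1 (G - η / 4) (by linarith)
  have h3 : ∀ᶠ N in atTop, ((k - η / 4 : ℝ) : EReal) ≤ (kinN N : EReal) := by
    by_cases hneg : k - η / 4 < 0
    · refine Eventually.of_forall fun N => le_trans ?_ (EReal.coe_ennreal_nonneg _)
      exact_mod_cast hneg.le
    · push Not at hneg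
      have : ENNReal.ofReal (k - η / 4) < liminf kinN atTop := by
        refine lt_of_lt_of_le ?_ hkl
        rw [hk', ENNReal.ofReal_lt_ofReal_iff (by linarith)]
        linarith
      filter_upwards [eventually_lt_of_lt_liminf this] with N hN
      have h4 : ((ENNReal.ofReal (k - η / 4) : ℝ≥0∞) : EReal) ≤ (kinN N : EReal) :=
        EReal.coe_ennreal_le_coe_ennreal_iff.2 hN.le
      rwa [EReal.coe_ennreal_ofReal, max_eq_left hneg] at h4
  filter_upwards [h1, h2, h3] with N a1 a2 a3
  by_contra hc
  push Not at hc
  have : ((k - η / 4 : ℝ) : EReal) - (c : EReal) + ((E + η : ℝ) : EReal) + ((G - η / 4 : ℝ) : EReal) ≤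
      ((kinN N : EReal) - (c : EReal)) + eN N + (GN N : EReal) := by
    refine add_le_add (add_le_add (EReal.sub_le_sub a3 le_rfl) hc.le) ?_
    exact_mod_cast a2.le
  have h5 := lt_of_le_of_lt this a1
  rw [← EReal.coe_sub, ← EReal.coe_add, ← EReal.coe_add, EReal.coe_lt_coe_iff] at h5
  linarith

lemma lower_M {d : ℕ} {T : ℝ} (hT : 0 < T) {f : ℝ → EReal} (hf : GoodF f) {Ω : Set (Euc d)}
    (hΩ : MeasurableSet Ω) (hΩv : volume Ω ≠ ⊤) (Q : Measure (Traj d T)) [IsProbabilityMeasure Q]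
    {φ : ℝ × Euc d → ℝ} (hφ : Continuous φ) {R δ ε E : ℝ} (hb : ∀ p, |φ p| ≤ R) (hε : 0 < ε)
    (h : ∀ t x y, φ (t, x) - φ (t, y) ≤ δ + dist x y ^ 2 / (2 * ε))
    (hE : eintegral (volume.restrict (Set.Ioc (0:ℝ) T))
        (fun t => moreauE Ω (intFE Ω f) ε (Q.map (evalAt hT.le t))) ≤ (E : EReal)) :
    (∫ t in Ioc 0 T, ∫ x, φ (t, x) ∂(Q.map (evalAt hT.le t))) -
      (∫ t in Ioc 0 T, ∫ x in Ω, fst f (φ (t, x))) - T * δ ≤ E := by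
  have hA := A_int hT.le Q hφ hb
  have hB := B_int (T := T) hf hΩv hφ hb
  have hc : Integrable (fun _ : ℝ => δ) (volume.restrict (Ioc 0 T)) := integrable_const δ
  have hi := (hA.sub hB).sub hc
  have hp := prob_map hT.le Q
  have key := (eint_coe hi).symm.le.trans ((eint_mono (ae_of_all _ fun t => by
    refine le_iInf fun ρ => le_iInf fun hρ => ?_
    have := hρ.1
    have hpt := hp t
    exact S1 (μ := Q.map (evalAt hT.le t)) hf hΩ hΩv hρ.2 (φ := fun x => φ (t, x)) (by fun_prop)
      (fun x => hb (t, x)) hε (h t))).trans hE)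
  rw [EReal.coe_le_coe_iff] at key
  rw [integral_sub' (hA.sub hB) hc, integral_sub' hA hB] at key
  have e : ∫ _ in Ioc 0 T, δ = T * δ := by simp [hT.le]
  rw [e] at key
  exact key

lemma support_lemma {d : ℕ} {T : ℝ} (hT : 0 < T) {f : ℝ → EReal} (hf : GoodF f) {Ω : Set (Euc d)}
    (hΩc : IsCompact Ω) (hΩ : MeasurableSet Ω) (hΩne : Ω.Nonempty)
    {Q : ℕ → Measure (Traj d T)} {Q' : Measure (Traj d T)} [IsProbabilityMeasure Q']
    (hQ : ∀ᶠ N in atTop, IsProbabilityMeasure (Q N)) (hcv : NarrowTendsto Q Q')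
    {ε : ℕ → ℝ} (hεpos : ∀ N, 0 < ε N) (hεlim : Tendsto ε atTop (𝓝 0)) {E : ℝ}
    (hE : ∀ η > 0, ∀ᶠ N in atTop, eintegral (volume.restrict (Set.Ioc (0:ℝ) T))
        (fun t => moreauE Ω (intFE Ω f) (ε N) ((Q N).map (evalAt hT.le t))) ≤ ((E + η : ℝ) : EReal)) :
    ∀ᵐ t ∂(volume.restrict (Ioc 0 T)), (Q'.map (evalAt hT.le t)) Ωᶜ = 0 := by
  have hΩv : volume Ω ≠ ⊤ := hΩc.measure_lt_top.ne
  set φ : ℝ × Euc d → ℝ := fun p => min (Metric.infDist p.2 Ω) 1 with hφdef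
  have hφ0 : ∀ p, 0 ≤ φ p := fun p => le_min Metric.infDist_nonneg zero_le_one
  have hφ1 : ∀ p, |φ p| ≤ 1 := fun p => by rw [abs_of_nonneg (hφ0 p)]; exact min_le_right _ _
  have hφl : LipschitzWith 1 φ := by
    have := ((Metric.lipschitz_infDist_pt Ω).comp (LipschitzWith.prod_snd (α := ℝ))).min_const 1
    simpa using this
  have hφc := hφl.continuous
  set B := ∫ t in Ioc 0 T, ∫ x in Ω, fst f 0
  set A := ∫ t in Ioc 0 T, ∫ x, φ (t, x) ∂(Q'.map (evalAt hT.le t))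
  have key : ∀ l : ℕ, l * A ≤ E + 1 + B + T := by
    intro l
    have hlb : ∀ p, |(l : ℝ) * φ p| ≤ l := fun p => by
      rw [abs_mul, Nat.abs_cast]
      exact mul_le_of_le_one_right (Nat.cast_nonneg l) (hφ1 p)
    have hlc : Continuous fun p => (l : ℝ) * φ p := by fun_prop
    have hlu : UniformContinuous fun p => (l : ℝ) * φ p :=
      hφl.uniformContinuous.const_smul (l : ℝ)
    have hlim := S2 hT.le hQ hcv hlc hlb
    have : (∫ t in Ioc 0 T, ∫ x, (l : ℝ) * φ (t, x) ∂(Q'.map (evalAt hT.le t))) = l * A := by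
      simp_rw [integral_const_mul]; rfl
    rw [this] at hlim
    refine le_of_tendsto hlim ?_
    filter_upwards [hQ, uc_bound hlu hlb hεpos hεlim one_pos, hE 1 one_pos] with N hN h1 h2
    have h3 := lower_M hT hf hΩ hΩv (Q N) hlc hlb (hεpos N) h1 h2
    have h4 : (∫ t in Ioc 0 T, ∫ x in Ω, fst f (l * φ (t, x))) = B := by
      refine integral_congr_ae (ae_of_all _ fun t => ?_)
      refine setIntegral_congr_fun hΩ fun x hx => ?_
      have : φ (t, x) = 0 := by simp [hφdef, Metric.infDist_zero_of_mem hx]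
      simp [this]
    rw [h4] at h3
    linarith
  have hA0 : 0 ≤ A := integral_nonneg fun t => integral_nonneg fun x => hφ0 _
  have hA : A = 0 := by
    by_contra hne
    have hpos : 0 < A := lt_of_le_of_ne hA0 (Ne.symm hne)
    obtain ⟨l, hl⟩ := exists_nat_gt ((E + 1 + B + T) / A)
    rw [div_lt_iff₀ hpos] at hl
    linarith [key l]
  have h5 := (integral_eq_zero_iff_of_nonneg (fun t => integral_nonneg fun x => hφ0 _)
    (A_int hT.le Q' hφc hφ1)).1 hA
  filter_upwards [h5] with t ht
  have hp := prob_map hT.le Q' t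
  have h6 := (integral_eq_zero_iff_of_nonneg (fun x => hφ0 (t, x))
    (integrable_bdd_cont (by fun_prop) (fun x => hφ1 (t, x)))).1 ht
  rw [EventuallyEq, ae_iff] at h6
  refine measure_mono_null (fun x hx => ?_) h6
  simp only [Set.mem_ofPred_eq, Pi.zero_apply, hφdef]
  have := (hΩc.isClosed.notMem_iff_infDist_pos hΩne).1 hx
  exact (lt_min this one_pos).ne'

lemma main_lemma {d : ℕ} {T : ℝ} (hT : 0 < T) {f : ℝ → EReal} (hf : GoodF f) {Ω : Set (Euc d)}
    (hΩc : IsCompact Ω) (hΩ : MeasurableSet Ω) (hΩne : Ω.Nonempty)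
    {Q : ℕ → Measure (Traj d T)} {Q' : Measure (Traj d T)} [IsProbabilityMeasure Q']
    (hQ : ∀ᶠ N in atTop, IsProbabilityMeasure (Q N)) (hcv : NarrowTendsto Q Q')
    {ε : ℕ → ℝ} (hεpos : ∀ N, 0 < ε N) (hεlim : Tendsto ε atTop (𝓝 0)) {E : ℝ}
    (hEe : eintegral (volume.restrict (Set.Ioc (0:ℝ) T))
        (fun t => intFE Ω f (Q'.map (evalAt hT.le t))) = (E : EReal))
    (hE : ∀ η > 0, ∀ᶠ N in atTop, eintegral (volume.restrict (Set.Ioc (0:ℝ) T))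
        (fun t => moreauE Ω (intFE Ω f) (ε N) ((Q N).map (evalAt hT.le t))) ≤ ((E + η : ℝ) : EReal))
    {ρproj : ℕ → ℝ → Measure (Euc d)}
    (hproj : ∀ N, ∀ t ∈ Set.Ioc (0:ℝ) T,
      IsProbabilityMeasure (ρproj N t) ∧ (ρproj N t) Ωᶜ = 0 ∧
      (((W2sq ((Q N).map (evalAt hT.le t)) (ρproj N t) / ENNReal.ofReal (2 * ε N))
          : ℝ≥0∞) : EReal) + intFE Ω f (ρproj N t)
        = moreauE Ω (intFE Ω f) (ε N) ((Q N).map (evalAt hT.le t)))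
    {κ p : ℝ} (hκ : 0 < κ)
    (hmod : ∀ a b y : ℝ, f a ≠ ⊤ → f b ≠ ⊤ →
      κ * |a - b| ^ p + y * ((a + b) / 2) - fst f y ≤ ((f a).toReal + (f b).toReal) / 2) :
    Tendsto (fun N => ∫⁻ t in Ioc 0 T, ∫⁻ x in Ω, ENNReal.ofReal
      (|((ρproj N t).rnDeriv volume x).toReal -
        ((Q'.map (evalAt hT.le t)).rnDeriv volume x).toReal| ^ p)) atTop (𝓝 0) := by
  have hΩv : volume Ω ≠ ⊤ := hΩc.measure_lt_top.ne
  have hsupp := support_lemma hT hf hΩc hΩ hΩne hQ hcv hεpos hεlim hE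
  obtain ⟨hd1, hd2, hd3, hd4⟩ := density_data hT.le hf hΩ hΩv Q' hsupp (by rw [hEe]; exact EReal.coe_ne_top _)
  rw [hEe, EReal.coe_eq_coe_iff] at hd3
  have main : ∀ η : ℝ, 0 < η → ∀ᶠ N in atTop, (∫⁻ t in Ioc 0 T, ∫⁻ x in Ω, ENNReal.ofReal
      (|((ρproj N t).rnDeriv volume x).toReal -
        ((Q'.map (evalAt hT.le t)).rnDeriv volume x).toReal| ^ p)) ≤ ENNReal.ofReal (5 * η / (2 * κ)) := by
    intro η hη
    obtain ⟨φ, hφc, hφs, hφ⟩ := hd4 η hη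
    obtain ⟨R, hR⟩ := hφs.exists_bound_of_continuous hφc
    have hb : ∀ q, |φ q| ≤ R := hR
    have hu := hφs.uniformContinuous_of_continuous hφc
    have hlim := S2 hT.le hQ hcv hφc hb
    have hA' := A_int hT.le Q' hφc hb
    have hB := B_int (T := T) hf hΩv hφc hb
    set A' := ∫ t in Ioc 0 T, ∫ x, φ (t, x) ∂(Q'.map (evalAt hT.le t))
    set B := ∫ t in Ioc 0 T, ∫ x in Ω, fst f (φ (t, x))
    filter_upwards [hQ, uc_bound hu hb hεpos hεlim (show 0 < η / T by positivity), hE η hη,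
      (tendsto_order.1 hlim).1 (A' - η) (by linarith)] with N hN h1 h2 h3
    have hA := A_int hT.le (Q N) hφc hb
    rw [lintegral_eq_nnreal]
    refine iSup_le fun s => iSup_le fun hs => ?_
    have hsi : Integrable (fun t => (s t : ℝ)) (volume.restrict (Ioc 0 T)) := by
      obtain ⟨K, hK⟩ := s.exists_forall_le
      refine Integrable.of_bound (C := K) ?_ (ae_of_all _ fun t => ?_)
      · exact s.measurable.coe_nnreal_real.aestronglyMeasurable
      · simpa using hK t
    have hc : Integrable (fun _ : ℝ => η / T) (volume.restrict (Ioc 0 T)) := integrable_const _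
    have hp := prob_map hT.le (Q N)
    have hp' := prob_map hT.le Q'
    have i1 := (hsi.const_mul (2 * κ)).add hA
    have i2 := i1.add hA'
    have i3 := i2.sub (hB.const_mul 2)
    have i4 := i3.sub hc
    have i5 := i4.sub hd2
    have key := (eint_coe i5).symm.le.trans ((eint_mono (by
      filter_upwards [hsupp, hd1, ae_restrict_mem measurableSet_Ioc] with t t1 t2 t3
      obtain ⟨r1, r2, r3⟩ := hproj N t t3
      have hpt := hp t
      have hpt' := hp' t
      rw [← r3]
      refine perT (μ := (Q N).map (evalAt hT.le t)) (σ := Q'.map (evalAt hT.le t)) hf hΩ hΩv r2 t1 t2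
        (φ := fun x => φ (t, x)) (by fun_prop) (fun x => hb (t, x)) (hεpos N) (h1 t) hκ hmod ?_
      rw [ENNReal.ofReal_coe_nnreal]
      exact hs t)).trans h2)
    rw [EReal.coe_le_coe_iff] at key
    rw [integral_sub' i4 hd2, integral_sub' i3 hc, integral_sub' i2 (hB.const_mul 2), integral_add' i1 hA',
      integral_add' (hsi.const_mul (2 * κ)) hA, integral_const_mul, integral_const_mul, ← hd3] at key
    have e : ∫ _ in Ioc 0 T, η / T = η := by
      simp [hT.le]
      field_simp
    rw [e] at key
    have hfin : ∫ t in Ioc 0 T, (s t : ℝ) ≤ 5 * η / (2 * κ) := by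
      rw [le_div_iff₀ (by positivity)]
      rw [← hd3] at hφ
      linarith
    have e2 : (s.map ((↑) : ℝ≥0 → ℝ≥0∞)).lintegral (volume.restrict (Ioc 0 T)) =
        ENNReal.ofReal (∫ t in Ioc 0 T, (s t : ℝ)) := by
      rw [← SimpleFunc.lintegral_eq_lintegral, ofReal_integral_eq_lintegral_ofReal hsi (ae_of_all _ fun t => by simp)]
      refine lintegral_congr fun t => ?_
      simp
    rw [e2]
    exact ENNReal.ofReal_le_ofReal hfin
  rw [ENNReal.tendsto_nhds_zero]
  intro x hx
  rcases eq_or_ne x ⊤ with rfl | hxt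
  · exact Eventually.of_forall fun _ => le_top
  have hx' : 0 < x.toReal := ENNReal.toReal_pos hx.ne' hxt
  filter_upwards [main (x.toReal * (2 * κ) / 5) (by positivity)] with N hN
  refine hN.trans ?_
  rw [show 5 * (x.toReal * (2 * κ) / 5) / (2 * κ) = x.toReal by field_simp, ENNReal.ofReal_toReal hxt]

lemma lp_tendsto {d : ℕ} {T : ℝ} {Ω : Set (Euc d)} {m : ℝ} (hm : 2 ≤ m) {u : ℕ → ℝ → Euc d → ℝ}
    (h : Tendsto (fun N => ∫⁻ t in Ioc 0 T, ∫⁻ x in Ω, ENNReal.ofReal (|u N t x| ^ m)) atTop (𝓝 0)) :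
    Tendsto (fun N => eLpNorm (fun p : ℝ × Euc d => u N p.1 p.2) (ENNReal.ofReal m)
      (volume.restrict (Set.Ioc (0:ℝ) T ×ˢ Ω))) atTop (𝓝 0) := by
  have hm0 : 0 < m := by linarith
  have h2 : Tendsto (fun N => (∫⁻ t in Ioc 0 T, ∫⁻ x in Ω, ENNReal.ofReal (|u N t x| ^ m)) ^ (1 / m)) atTop (𝓝 0) := by
    have := (ENNReal.continuous_rpow_const (y := 1 / m)).tendsto 0 |>.comp h
    rwa [ENNReal.zero_rpow_of_pos (by positivity)] at this
  refine tendsto_of_tendsto_of_tendsto_of_le_of_le tendsto_const_nhds h2 (fun _ => zero_le) fun N => ?_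
  simp only
  rw [eLpNorm_eq_lintegral_rpow_enorm_toReal (by simp [hm0]) (by simp), ENNReal.toReal_ofReal hm0.le,
    Measure.volume_eq_prod, ← Measure.prod_restrict]
  refine ENNReal.rpow_le_rpow ((lintegral_prod_le' _).trans (le_of_eq ?_)) (by positivity)
  refine lintegral_congr fun t => lintegral_congr fun x => ?_
  rw [← ofReal_norm, ENNReal.ofReal_rpow_of_nonneg (norm_nonneg _) hm0.le, Real.norm_eq_abs]

lemma intFE_top {d : ℕ} {Ω : Set (Euc d)} {f : ℝ → EReal} (hf : ∀ s, f s = ⊤) (hΩ : volume Ω ≠ 0)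
    (ρ : Measure (Euc d)) : intFE Ω f ρ = ⊤ := by
  unfold intFE
  split_ifs
  · simp only [hf]
    exact eint_top (by simpa using hΩ)
  · rfl

lemma assembly
    (d : ℕ) (hd : 0 < d) (T : ℝ) (hT : 0 < T)
    (Ω : Set (Euc d)) (hΩc : IsCompact Ω) (hΩmeas : MeasurableSet Ω) (hΩne : Ω.Nonempty)
    (r C : ℝ) (hr : 1 < r) (hC : 0 < C)
    (L : Euc d → ℝ) (hLconv : ConvexOn ℝ Set.univ L) (hLcont : Continuous L)
    (hLgrow : ∀ p : Euc d, 1 / (r * C) * ‖p‖ ^ r - C ≤ L p ∧ L p ≤ C / r * ‖p‖ ^ r + C)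
    (f : ℝ → EReal) (hfbot : ∀ t, f t ≠ ⊥) (hfconv : ConvexE f)
    (hflsc : LowerSemicontinuous f) (hfsl : SuperlinearE f)
    (G : Measure (Traj d T) → ℝ)
    (hGcont : ∀ (Q : ℕ → Measure (Traj d T)) (Q' : Measure (Traj d T)),
      (∀ n, IsProbabilityMeasure (Q n)) → IsProbabilityMeasure Q' →
      NarrowTendsto Q Q' → Tendsto (fun n => G (Q n)) atTop (𝓝 (G Q')))
    (μ0 : Measure (Euc d)) (hμ0 : IsProbabilityMeasure μ0)
    (hμ0Ω : μ0 Ωᶜ = 0) (hμ0ac : μ0 ≪ volume)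
    (Qmin : Measure (Traj d T)) (hQminP : IsProbabilityMeasure Qmin)
    (hQminmin : ∀ Q : Measure (Traj d T), IsProbabilityMeasure Q →
      Q.map (evalAt hT.le 0) = μ0 →
      JfunE hT.le Ω L C f G Qmin ≤ JfunE hT.le Ω L C f G Q)
    (hQminuniq : ∀ Q : Measure (Traj d T), IsProbabilityMeasure Q →
      Q.map (evalAt hT.le 0) = μ0 →
      (∀ Q' : Measure (Traj d T), IsProbabilityMeasure Q' →
        Q'.map (evalAt hT.le 0) = μ0 →
        JfunE hT.le Ω L C f G Q ≤ JfunE hT.le Ω L C f G Q') → Q = Qmin)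
    (ε : ℕ → ℝ)
    (Q : ℕ → Measure (Traj d T))
    (hQdisc : ∀ N, IsUnifDiscrete N (Q N))
    (hQcv : NarrowTendsto Q Qmin)
    (hJcv : Tendsto (fun N => JepsE hT.le Ω L C f G (ε N) (Q N)) atTop
      (𝓝 (JfunE hT.le Ω L C f G Qmin))) :
    GoodF f ∧ ∃ E : ℝ, eintegral (volume.restrict (Set.Ioc (0:ℝ) T))
        (fun t => intFE Ω f (Qmin.map (evalAt hT.le t))) = (E : EReal) ∧
      ∀ η > 0, ∀ᶠ N in atTop, eintegral (volume.restrict (Set.Ioc (0:ℝ) T))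
        (fun t => moreauE Ω (intFE Ω f) (ε N) ((Q N).map (evalAt hT.le t))) ≤ ((E + η : ℝ) : EReal) := by
  have hJ := J_ne_top hd hT hΩc hΩmeas hμ0 hμ0Ω hQminmin hQminuniq
  have hΩv : volume Ω ≠ ⊤ := hΩc.measure_lt_top.ne
  have hΩ0 : volume Ω ≠ 0 := by
    intro h0
    have h1 : μ0 Ω = 1 := (prob_compl_eq_zero_iff hΩmeas (μ := μ0)).1 hμ0Ω
    rw [hμ0ac h0] at h1
    exact zero_ne_one h1
  have hIoc : (volume.restrict (Ioc (0:ℝ) T)) univ ≠ 0 := by simpa using hT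
  set e := eintegral (volume.restrict (Set.Ioc (0:ℝ) T))
        (fun t => intFE Ω f (Qmin.map (evalAt hT.le t))) with he
  have hkinbot : kinE L C Qmin ≠ ⊥ := by
    unfold kinE
    have : ((0:ℝ) : EReal) - ((C * T : ℝ) : EReal) ≤
        ((∫⁻ γ, actionN L C γ ∂Qmin : ℝ≥0∞) : EReal) - ((C * T : ℝ) : EReal) :=
      EReal.sub_le_sub (EReal.coe_ennreal_nonneg _) le_rfl
    intro h
    rw [h, ← EReal.coe_sub, le_bot_iff] at this
    exact EReal.coe_ne_bot _ this
  have hetop : e ≠ ⊤ := by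
    intro h
    apply hJ
    unfold JfunE
    rw [← he, h, EReal.add_top_of_ne_bot hkinbot, EReal.top_add_coe]
  have hf : GoodF f := by
    refine ⟨hfbot, hfconv, hflsc, hfsl, ?_⟩
    by_contra hn
    push Not at hn
    apply hetop
    simp only [he, intFE_top hn hΩ0]
    exact eint_top hIoc
  have hebot : e ≠ ⊥ := by
    have := eint_ge (μ := volume.restrict (Set.Ioc (0:ℝ) T))
      (g := fun t => intFE Ω f (Qmin.map (evalAt hT.le t))) _
      (ae_of_all _ fun t => intFE_ge hf hΩv _)
    intro h
    rw [← he, h, le_bot_iff] at this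
    exact EReal.coe_ne_bot _ this
  have heE : e = (e.toReal : EReal) := (EReal.coe_toReal hetop hebot).symm
  have hk : (∫⁻ γ, actionN L C γ ∂Qmin) ≠ ⊤ := by
    intro h
    apply hJ
    unfold JfunE kinE
    rw [← he, h, heE, EReal.coe_ennreal_top, EReal.top_sub_coe, EReal.top_add_coe, EReal.top_add_coe]
  have hfinQ : ∀ N, IsFiniteMeasure (Q N) := fun N => unif_finite (hQdisc N)
  refine ⟨hf, e.toReal, heE, fun η hη => ?_⟩
  refine limsup_M hk (kin_lsc hT hr hC hLconv hLcont (fun p => (hLgrow p).1) hQcv) (G := G Qmin)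
    (GN := fun N => G (Q N)) (c := C * T) ?_ heE hJcv hη
  rw [← tendsto_add_atTop_iff_nat 1]
  exact hGcont (fun n => Q (n + 1)) Qmin (fun n => unif_prob (by omega) (hQdisc (n + 1))) hQminP
    (fun g => (tendsto_add_atTop_iff_nat 1).2 (hQcv g))

lemma subsingleton_case {d : ℕ} (hd : d = 0) (μ ν : Measure (Euc d)) [IsProbabilityMeasure μ]
    [IsProbabilityMeasure ν] : μ = ν := by
  subst hd
  ext s _
  rcases s.eq_empty_or_nonempty with rfl | ⟨x, hx⟩
  · simp
  · have : s = univ := eq_univ_of_forall fun y => by rwa [Subsingleton.elim y x]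
    rw [this]; simp

lemma subsingleton_lp {d : ℕ} (hd : d = 0) {T : ℝ} (hT : 0 < T) {Ω : Set (Euc d)} (hΩ : MeasurableSet Ω)
    {ρproj : ℕ → ℝ → Measure (Euc d)}
    (hρ : ∀ N, ∀ t ∈ Ioc (0:ℝ) T, IsProbabilityMeasure (ρproj N t))
    (Qmin : Measure (Traj d T)) [IsProbabilityMeasure Qmin] (q : ℝ≥0∞) :
    Tendsto (fun N => eLpNorm (fun p : ℝ × Euc d => ((ρproj N p.1).rnDeriv volume p.2).toReal
              - ((Qmin.map (evalAt hT.le p.1)).rnDeriv volume p.2).toReal)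
          q (volume.restrict (Set.Ioc (0:ℝ) T ×ˢ Ω))) atTop (𝓝 0) := by
  refine tendsto_const_nhds.congr fun N => ?_
  symm
  rw [eLpNorm_congr_ae (g := fun _ => (0:ℝ)), eLpNorm_zero']
  filter_upwards [ae_restrict_mem (measurableSet_Ioc.prod hΩ)] with p hp
  have h1 := hρ N p.1 hp.1
  have h2 := prob_map hT.le Qmin p.1
  rw [subsingleton_case hd (ρproj N p.1) (Qmin.map (evalAt hT.le p.1)), sub_self]

/-- **strong convergence of the Moreau projections.** In the setting of
the previous statement: (i) if `f` is strongly convex then the densities of the Moreau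
projections `ρ_N` converge strongly in `L²([0,T]×Ω)` to `ρ_min : (t,x) ↦ (e_t#Q_min)(x)`;
(ii) if `f(ρ) = |ρ|^m` with `m ≥ 2`, the convergence holds strongly in `L^m([0,T]×Ω)`. -/
theorem strong_convergence_of_projections
    (d : ℕ) (T : ℝ) (hT : 0 < T)
    (Ω : Set (Euc d)) (hΩc : IsCompact Ω) (hΩmeas : MeasurableSet Ω) (hΩne : Ω.Nonempty)
    (r C : ℝ) (hr : 1 < r) (hC : 0 < C)
    (L : Euc d → ℝ) (hLconv : ConvexOn ℝ Set.univ L) (hLcont : Continuous L)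
    (hLgrow : ∀ p : Euc d, 1 / (r * C) * ‖p‖ ^ r - C ≤ L p ∧ L p ≤ C / r * ‖p‖ ^ r + C)
    (f : ℝ → EReal) (hfbot : ∀ t, f t ≠ ⊥) (hfconv : ConvexE f)
    (hflsc : LowerSemicontinuous f) (hfsl : SuperlinearE f)
    (G : Measure (Traj d T) → ℝ)
    (hGcont : ∀ (Q : ℕ → Measure (Traj d T)) (Q' : Measure (Traj d T)),
      (∀ n, IsProbabilityMeasure (Q n)) → IsProbabilityMeasure Q' →
      NarrowTendsto Q Q' → Tendsto (fun n => G (Q n)) atTop (𝓝 (G Q')))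
    (hGbdd : BddBelow (Set.range G))
    (μ0 : Measure (Euc d)) (hμ0 : IsProbabilityMeasure μ0)
    (hμ0Ω : μ0 Ωᶜ = 0) (hμ0ac : μ0 ≪ volume)
    -- `Q_min`, the unique minimizer of the continuous problem
    (Qmin : Measure (Traj d T)) (hQminP : IsProbabilityMeasure Qmin)
    (hQmin0 : Qmin.map (evalAt hT.le 0) = μ0)
    (hQminmin : ∀ Q : Measure (Traj d T), IsProbabilityMeasure Q →
      Q.map (evalAt hT.le 0) = μ0 →
      JfunE hT.le Ω L C f G Qmin ≤ JfunE hT.le Ω L C f G Q)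
    (hQminuniq : ∀ Q : Measure (Traj d T), IsProbabilityMeasure Q →
      Q.map (evalAt hT.le 0) = μ0 →
      (∀ Q' : Measure (Traj d T), IsProbabilityMeasure Q' →
        Q'.map (evalAt hT.le 0) = μ0 →
        JfunE hT.le Ω L C f G Q ≤ JfunE hT.le Ω L C f G Q') → Q = Qmin)
    -- the parameters and the minimizers `Q_N` of the discretized problems
    (ε : ℕ → ℝ) (hεpos : ∀ N, 0 < ε N) (hεlim : Tendsto ε atTop (𝓝 0))
    (μ0N : ℕ → Measure (Euc d)) (hμ0N : ∀ N, IsUnifDiscrete N (μ0N N) ∧ (μ0N N) Ωᶜ = 0)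
    (Q : ℕ → Measure (Traj d T))
    (hQdisc : ∀ N, IsUnifDiscrete N (Q N) ∧ (Q N).map (evalAt hT.le 0) = μ0N N)
    (hQminN : ∀ N, ∀ Q' : Measure (Traj d T), IsUnifDiscrete N Q' →
      Q'.map (evalAt hT.le 0) = μ0N N →
      JepsE hT.le Ω L C f G (ε N) (Q N) ≤ JepsE hT.le Ω L C f G (ε N) Q')
    -- chosen so that `Q_N → Q_min` narrowly and `J_{ε_N}(Q_N) → J(Q_min)`
    (hQcv : NarrowTendsto Q Qmin)
    (hJcv : Tendsto (fun N => JepsE hT.le Ω L C f G (ε N) (Q N)) atTop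
      (𝓝 (JfunE hT.le Ω L C f G Qmin)))
    -- the Moreau projections `ρ_N(t)` of `e_t#Q_N`
    (ρproj : ℕ → ℝ → Measure (Euc d))
    (hproj : ∀ N, ∀ t ∈ Set.Ioc (0:ℝ) T,
      IsProbabilityMeasure (ρproj N t) ∧ (ρproj N t) Ωᶜ = 0 ∧
      (((W2sq ((Q N).map (evalAt hT.le t)) (ρproj N t) / ENNReal.ofReal (2 * ε N))
          : ℝ≥0∞) : EReal) + intFE Ω f (ρproj N t)
        = moreauE Ω (intFE Ω f) (ε N) ((Q N).map (evalAt hT.le t))) :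
    -- (i) the strongly convex case: strong convergence in `L²([0,T]×Ω)`
    ((∃ c : ℝ, 0 < c ∧ ∀ a b : ℝ, ∀ u ∈ Set.Icc (0:ℝ) 1,
        f (u * a + (1 - u) * b)
          ≤ ((u : ℝ) : EReal) * f a + (((1 - u : ℝ)) : EReal) * f b
            - ((c / 2 * u * (1 - u) * (a - b) ^ 2 : ℝ) : EReal)) →
      Tendsto
        (fun N => eLpNorm
          (fun p : ℝ × Euc d =>
            ((ρproj N p.1).rnDeriv volume p.2).toReal
              - ((Qmin.map (evalAt hT.le p.1)).rnDeriv volume p.2).toReal)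
          2 (volume.restrict (Set.Ioc (0:ℝ) T ×ˢ Ω)))
        atTop (𝓝 0))
    -- (ii) the power case `f(ρ) = |ρ|^m`, `m ≥ 2`: strong convergence in `L^m([0,T]×Ω)`
    ∧ (∀ m : ℝ, 2 ≤ m → (∀ t : ℝ, f t = ((|t| ^ m : ℝ) : EReal)) →
      Tendsto
        (fun N => eLpNorm
          (fun p : ℝ × Euc d =>
            ((ρproj N p.1).rnDeriv volume p.2).toReal
              - ((Qmin.map (evalAt hT.le p.1)).rnDeriv volume p.2).toReal)
          (ENNReal.ofReal m) (volume.restrict (Set.Ioc (0:ℝ) T ×ˢ Ω)))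
        atTop (𝓝 0)) := by
  rcases Nat.eq_zero_or_pos d with hd | hd
  · exact ⟨fun _ => subsingleton_lp hd hT hΩmeas (fun N t ht => (hproj N t ht).1) Qmin 2,
      fun m _ _ => subsingleton_lp hd hT hΩmeas (fun N t ht => (hproj N t ht).1) Qmin _⟩
  obtain ⟨hf, E, hEe, hE⟩ := assembly d hd T hT Ω hΩc hΩmeas hΩne r C hr hC L hLconv hLcont hLgrow f hfbot
    hfconv hflsc hfsl G hGcont μ0 hμ0 hμ0Ω hμ0ac Qmin hQminP hQminmin hQminuniq ε Q
    (fun N => (hQdisc N).1) hQcv hJcv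
  have hQ : ∀ᶠ N in atTop, IsProbabilityMeasure (Q N) := by
    filter_upwards [eventually_ge_atTop 1] with N hN
    exact unif_prob hN (hQdisc N).1
  have hhalf : (1 / 2 : ℝ) ∈ Set.Icc (0:ℝ) 1 := by constructor <;> norm_num
  constructor
  · rintro ⟨c, hc, hsc⟩
    have h := lp_tendsto (u := fun N t x => ((ρproj N t).rnDeriv volume x).toReal - ((Qmin.map (evalAt hT.le t)).rnDeriv volume x).toReal) (le_refl 2)
      (main_lemma hT hf hΩc hΩmeas hΩne hQ hQcv hεpos hεlim hEe hE hproj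
      (κ := c / 8) (p := 2) (by positivity) (fun a b y ha hb => by
        refine hf.modulus ?_ ha hb y
        have h1 := hsc a b (1 / 2) hhalf
        have e : c / 2 * (1 / 2) * (1 - 1 / 2) * (a - b) ^ 2 = c / 8 * |a - b| ^ (2:ℝ) := by
          rw [Real.rpow_two, sq_abs]; ring
        rwa [e] at h1))
    rwa [show ENNReal.ofReal 2 = 2 by simp] at h
  · intro m hm hfm
    refine lp_tendsto (u := fun N t x => ((ρproj N t).rnDeriv volume x).toReal - ((Qmin.map (evalAt hT.le t)).rnDeriv volume x).toReal) hm
      (main_lemma hT hf hΩc hΩmeas hΩne hQ hQcv hεpos hεlim hEe hE hproj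
      (κ := (1 / 2) ^ m) (p := m) (by positivity) (fun a b y ha hb => by
        refine hf.modulus ?_ ha hb y
        rw [hfm, hfm, hfm, ← EReal.coe_mul, ← EReal.coe_mul, ← EReal.coe_add, ← EReal.coe_sub,
          EReal.coe_le_coe_iff]
        exact clarkson hm a b))

end
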